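/- Let V ⊆ ℝ^m be a nonempty semialgebraic open set and let Z ⊆ ℝ^m × ℝ^n be a semialgebraic set whose closure contains V × {0} and with Z ∩ (V × {0}) = ∅. Then there exist a nonempty semialgebraic open subset U ⊆ V, a real number a > 0, and a semialgebraic continuous map c : U × [0, a) → ℝ^n such that c(x, 0) = 0 for all x ∈ U, (x, c(x,t)) ∈ Z and |c(x,t)| = t for all t ≠ 0, and c is of class C^k on U × (0, a). -/

import Mathlib

open Set Topology Filter MeasureTheory Function

noncomputable section

/-- Semialgebraic subsets of `ℝ^m` (finite boolean combinations of polynomial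
equalities and inequalities). -/
inductive IsSA : ∀ {m : ℕ}, Set (Fin m → ℝ) → Prop
  | pos {m : ℕ} (p : MvPolynomial (Fin m) ℝ) : IsSA {x | 0 < MvPolynomial.eval x p}
  | zero {m : ℕ} (p : MvPolynomial (Fin m) ℝ) : IsSA {x | MvPolynomial.eval x p = 0}
  | union {m : ℕ} {s t : Set (Fin m → ℝ)} : IsSA s → IsSA t → IsSA (s ∪ t)
  | compl {m : ℕ} {s : Set (Fin m → ℝ)} : IsSA s → IsSA sᶜ

/-- Identification `ℝ^(m+n) ≃ ℝ^m × ℝ^n`. -/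
def pairEquiv (m n : ℕ) : (Fin (m + n) → ℝ) ≃ (Fin m → ℝ) × (Fin n → ℝ) :=
  (Equiv.arrowCongr finSumFinEquiv.symm (Equiv.refl ℝ)).trans
    (Equiv.sumArrowEquivProdArrow _ _ ℝ)

/-- The Euclidean norm on `ℝ^n`. -/
def euclNorm {n : ℕ} (u : Fin n → ℝ) : ℝ := Real.sqrt (∑ i, u i ^ 2)

/-- Euclidean closed disk. -/
def euclDisk {m : ℕ} (c : Fin m → ℝ) (r : ℝ) : Set (Fin m → ℝ) := {x | euclNorm (x - c) ≤ r}

/-- Locally semialgebraic set (the paper's convention of "semialgebraic"). -/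
def IsLSA {m : ℕ} (X : Set (Fin m → ℝ)) : Prop :=
  ∀ (c : Fin m → ℝ) (r : ℝ), IsSA (X ∩ euclDisk c r)

/-- The graph of `f` over `X`, as a subset of `ℝ^(m+n)`. -/
def graphSet {m n : ℕ} (X : Set (Fin m → ℝ)) (f : (Fin m → ℝ) → Fin n → ℝ) :
    Set (Fin (m + n) → ℝ) :=
  {z | (pairEquiv m n z).1 ∈ X ∧ f (pairEquiv m n z).1 = (pairEquiv m n z).2}

/-- Semialgebraic map on `X` (graph is semialgebraic). -/
def IsSAMapOn {m n : ℕ} (X : Set (Fin m → ℝ)) (f : (Fin m → ℝ) → Fin n → ℝ) : Prop :=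
  IsSA (graphSet X f)

/-- Locally semialgebraic map on `X`. -/
def IsLSAMapOn {m n : ℕ} (X : Set (Fin m → ℝ)) (f : (Fin m → ℝ) → Fin n → ℝ) : Prop :=
  ∀ X' ⊆ X, IsSA X' → IsCompact X' → IsSAMapOn X' f

/-- The closed geometric simplex spanned by a finite vertex set. -/
def simplexOf {N : ℕ} (σ : Finset (Fin N → ℝ)) : Set (Fin N → ℝ) := convexHull ℝ ↑σ

/-- Local finiteness of a simplicial complex. -/
def LocFinComplex {N : ℕ} (K : Geometry.SimplicialComplex ℝ (Fin N → ℝ)) : Prop :=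
  ∀ x : Fin N → ℝ, ∃ U : Set (Fin N → ℝ), IsOpen U ∧ x ∈ U ∧
    {σ | σ ∈ K.faces ∧ (simplexOf σ ∩ U).Nonempty}.Finite

/-- `f` is of class `C^1` on each closed simplex of `K`: on every closed simplex it
extends to a `C^1` map on an open neighborhood. -/
def C1OnSimplices {N m : ℕ} (K : Geometry.SimplicialComplex ℝ (Fin N → ℝ))
    (f : (Fin N → ℝ) → Fin m → ℝ) : Prop :=
  ∀ σ ∈ K.faces, ∃ (U : Set (Fin N → ℝ)) (g : (Fin N → ℝ) → Fin m → ℝ),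
    IsOpen U ∧ simplexOf σ ⊆ U ∧ ContDiffOn ℝ 1 g U ∧ EqOn f g (simplexOf σ)

/-- A semialgebraic triangulation of `X ⊆ ℝ^m`: a locally finite simplicial complex `K`
realized in `ℝ^N` together with a semialgebraic homeomorphism `f : |K| → X`. -/
structure SATriangulation {m : ℕ} (X : Set (Fin m → ℝ)) (N : ℕ) where
  K : Geometry.SimplicialComplex ℝ (Fin N → ℝ)
  f : (Fin N → ℝ) → Fin m → ℝ
  locFin : LocFinComplex K
  bij : Set.BijOn f K.space X
  cont : ContinuousOn f K.space
  inv_cont : ContinuousOn (Function.invFunOn f K.space) X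
  sa : IsLSAMapOn K.space f


/-! ### Sign matching of univariate real polynomials -/

/-- `y` and its partner have the same position relative to a finite set of matched pairs. -/
def SP (f : Finset (ℝ × ℝ)) (y y' : ℝ) : Prop :=
  ∀ p ∈ f, (p.1 < y ↔ p.2 < y') ∧ (y < p.1 ↔ y' < Prod.snd p)

/-- A finite partial order isomorphism. -/
def PIso (f : Finset (ℝ × ℝ)) : Prop := ∀ p ∈ f, SP f p.1 p.2

theorem SP.eq_right {f : Finset (ℝ × ℝ)} {y y' z : ℝ} (h : SP f y y') (hz : (y, z) ∈ f) :
    y' = z := by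
  have := h _ hz
  simp only [lt_self_iff_false, false_iff, not_lt] at this
  exact le_antisymm this.1 this.2

theorem PIso.across {f : Finset (ℝ × ℝ)} (hf : PIso f) (y : ℝ) : ∃ y', SP f y y' := by
  by_cases hy : ∃ z, (y, z) ∈ f
  · obtain ⟨z, hz⟩ := hy
    exact ⟨z, hf _ hz⟩
  · obtain ⟨m, h1, h2⟩ := Order.exists_between_finsets
      ((f.filter (fun p => p.1 < y)).image Prod.snd) ((f.filter (fun p => y < p.1)).image Prod.snd)
      (by
        intro a ha b hb
        simp only [Finset.mem_image, Finset.mem_filter] at ha hb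
        obtain ⟨p, ⟨hp, hpy⟩, rfl⟩ := ha
        obtain ⟨q, ⟨hq, hqy⟩, rfl⟩ := hb
        exact ((hf q hq) p hp).1.1 (hpy.trans hqy))
    refine ⟨m, fun p hp => ?_⟩
    rcases lt_trichotomy p.1 y with h | h | h
    · have := h1 p.2 (Finset.mem_image_of_mem _ (Finset.mem_filter.2 ⟨hp, h⟩))
      exact ⟨iff_of_true h this, iff_of_false h.not_gt this.not_gt⟩
    · exact absurd ⟨p.2, by rw [← h]; exact hp⟩ hy
    · have := h2 p.2 (Finset.mem_image_of_mem _ (Finset.mem_filter.2 ⟨hp, h⟩))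
      exact ⟨iff_of_false h.not_gt this.not_gt, iff_of_true h this⟩

theorem sp_swap {f : Finset (ℝ × ℝ)} {y y' : ℝ} : SP (f.image Prod.swap) y' y ↔ SP f y y' := by
  simp only [SP, Finset.mem_image]
  constructor
  · intro h p hp
    have := h p.swap ⟨p, hp, rfl⟩
    exact ⟨this.1.symm, this.2.symm⟩
  · rintro h _ ⟨p, hp, rfl⟩
    exact ⟨(h p hp).1.symm, (h p hp).2.symm⟩

theorem PIso.swap {f : Finset (ℝ × ℝ)} (hf : PIso f) : PIso (f.image Prod.swap) := by
  intro p hp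
  obtain ⟨q, hq, rfl⟩ := Finset.mem_image.1 hp
  exact sp_swap.2 (hf q hq)

def negPair (p : ℝ × ℝ) : ℝ × ℝ := (-p.1, -p.2)

theorem sp_neg {f : Finset (ℝ × ℝ)} {y y' : ℝ} : SP (f.image negPair) y y' ↔ SP f (-y) (-y') := by
  simp only [SP, Finset.mem_image]
  constructor
  · intro h p hp
    have := h (negPair p) ⟨p, hp, rfl⟩
    simp only [negPair] at this
    constructor
    · rw [lt_neg, lt_neg (b := y')]; exact this.2
    · rw [neg_lt, neg_lt (a := y')]; exact this.1
  · rintro h _ ⟨p, hp, rfl⟩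
    have := h p hp
    simp only [negPair]
    constructor
    · rw [neg_lt, neg_lt (b := y')]; exact this.2
    · rw [lt_neg, lt_neg (a := y')]; exact this.1

/-- points to the right of the partner within the same gap -/
theorem key_pos {f : Finset (ℝ × ℝ)} {p p' : Polynomial ℝ} {y y' : ℝ}
    (hf : PIso f) (hsp : SP f y y') (hy : ∀ q ∈ f, q.1 ≠ y)
    (hd : ∀ z, SP f z y' → 0 < p.derivative.eval z)
    (hd' : ∀ z, SP f y z → 0 < p'.derivative.eval z)
    (hend : ∀ q ∈ f, SignType.sign (p.eval q.1) = SignType.sign (p'.eval q.2))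
    (hpos : 0 < p.eval y) : ∃ z, SP f y z ∧ 0 < p'.eval z := by
  have hy' : ∀ q ∈ f, q.2 ≠ y' := by
    intro q hq h
    apply hy q hq
    have := hsp q hq
    rw [h] at this
    simp only [lt_self_iff_false, iff_false, not_lt] at this
    exact le_antisymm this.2 this.1
  by_cases hne : (f.filter (fun q => y < q.1)).Nonempty
  · obtain ⟨b, hb, hmin⟩ := Finset.exists_min_image _ Prod.fst hne
    rw [Finset.mem_filter] at hb
    have hgap : ∀ z, y ≤ z → z < b.1 → SP f z y' := by
      intro z hz1 hz2 q hq
      rcases lt_or_gt_of_ne (hy q hq) with h | h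
      · have h3 := (hsp q hq).1.1 h
        exact ⟨iff_of_true (h.trans_le hz1) h3, iff_of_false (h.trans_le hz1).not_gt h3.not_gt⟩
      · have h3 := (hsp q hq).2.1 h
        have h4 : z < q.1 := hz2.trans_le (hmin q (Finset.mem_filter.2 ⟨hq, h⟩))
        exact ⟨iff_of_false h4.not_gt h3.not_gt, iff_of_true h4 h3⟩
    have hgap' : ∀ z, y' ≤ z → z < b.2 → SP f y z := by
      intro z hz1 hz2 q hq
      rcases lt_or_gt_of_ne (hy q hq) with h | h
      · have h3 := (hsp q hq).1.1 h
        exact ⟨iff_of_true h (h3.trans_le hz1), iff_of_false h.not_gt (h3.trans_le hz1).not_gt⟩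
      · have h3 := hmin q (Finset.mem_filter.2 ⟨hq, h⟩)
        have h4 : b.2 ≤ q.2 := by
          rw [← not_lt, ← (hf b hb.1 q hq).1]; exact h3.not_gt
        have h5 := hz2.trans_le h4
        exact ⟨iff_of_false h.not_gt h5.not_gt, iff_of_true h h5⟩
    have hmono : StrictMonoOn (fun z => p.eval z) (Icc y b.1) := by
      apply strictMonoOn_of_deriv_pos (convex_Icc _ _) p.continuous.continuousOn
      intro z hz
      rw [interior_Icc] at hz
      rw [Polynomial.deriv]
      exact hd z (hgap z hz.1.le hz.2)
    have hb1 : 0 < p.eval b.1 :=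
      hpos.trans (hmono ⟨le_rfl, hb.2.le⟩ ⟨hb.2.le, le_rfl⟩ hb.2)
    have hb2 : 0 < p'.eval b.2 := by
      have := hend b hb.1
      rw [sign_pos hb1] at this
      exact sign_eq_one_iff.1 this.symm
    have hyb : y' < b.2 := (hsp b hb.1).2.1 hb.2
    have hev : ∀ᶠ z in 𝓝[<] b.2, 0 < p'.eval z :=
      (p'.continuous.continuousAt.eventually (lt_mem_nhds hb2)).filter_mono nhdsWithin_le_nhds
    have hev2 : ∀ᶠ z in 𝓝[<] b.2, z ∈ Ioo y' b.2 := Ioo_mem_nhdsLT hyb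
    obtain ⟨z, hz1, hz2⟩ := (hev.and hev2).exists
    exact ⟨z, hgap' z hz2.1.le hz2.2, hz1⟩
  · have hno : ∀ q ∈ f, q.1 < y := by
      intro q hq
      rcases lt_or_gt_of_ne (hy q hq) with h | h
      · exact h
      · exact absurd ⟨q, Finset.mem_filter.2 ⟨hq, h⟩⟩ hne
    have hgap' : ∀ z, y' ≤ z → SP f y z := by
      intro z hz q hq
      have h := hno q hq
      have h3 := (hsp q hq).1.1 h
      exact ⟨iff_of_true h (h3.trans_le hz), iff_of_false h.not_gt (h3.trans_le hz).not_gt⟩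
    have hmono : StrictMonoOn (fun z => p'.eval z) (Ici y') := by
      apply strictMonoOn_of_deriv_pos (convex_Ici _) p'.continuous.continuousOn
      intro z hz
      rw [interior_Ici] at hz
      rw [Polynomial.deriv]
      exact hd' z (hgap' z (le_of_lt hz))
    have hdeg : 0 < p'.degree := by
      by_contra hcon
      rw [not_lt] at hcon
      rw [Polynomial.eq_C_of_degree_le_zero hcon] at hd'
      simpa using hd' y' hsp
    have htop : Tendsto (fun z => p'.eval z) atTop atTop := by
      rcases le_total 0 p'.leadingCoeff with h | h
      · exact p'.tendsto_atTop_of_leadingCoeff_nonneg hdeg h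
      · have hb := p'.tendsto_atBot_of_leadingCoeff_nonpos hdeg h
        obtain ⟨z, hz1, hz2⟩ := ((hb.eventually (eventually_lt_atBot (p'.eval y'))).and
          (eventually_ge_atTop y')).exists
        exact absurd (hmono.monotoneOn (Set.mem_Ici.2 le_rfl) hz2 hz2) (not_le.2 hz1)
    obtain ⟨z, hz1, hz2⟩ := ((htop.eventually (eventually_gt_atTop 0)).and
          (eventually_ge_atTop y')).exists
    exact ⟨z, hgap' z hz2, hz1⟩

theorem key_neg {f : Finset (ℝ × ℝ)} {p p' : Polynomial ℝ} {y y' : ℝ}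
    (hf : PIso f) (hsp : SP f y y') (hy : ∀ q ∈ f, q.1 ≠ y)
    (hd : ∀ z, SP f z y' → p.derivative.eval z < 0)
    (hd' : ∀ z, SP f y z → p'.derivative.eval z < 0)
    (hend : ∀ q ∈ f, SignType.sign (p.eval q.1) = SignType.sign (p'.eval q.2))
    (hpos : 0 < p.eval y) : ∃ z, SP f y z ∧ 0 < p'.eval z := by
  have := key_pos (f := f.image negPair) (p := p.comp (-Polynomial.X))
    (p' := p'.comp (-Polynomial.X)) (y := -y) (y' := -y') ?_ ?_ ?_ ?_ ?_ ?_ ?_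
  · obtain ⟨z, hz1, hz2⟩ := this
    rw [sp_neg, neg_neg] at hz1
    exact ⟨-z, hz1, by simpa using hz2⟩
  · intro q hq
    obtain ⟨r, hr, rfl⟩ := Finset.mem_image.1 hq
    rw [sp_neg]
    simpa [negPair] using hf r hr
  · rw [sp_neg]; simpa using hsp
  · intro q hq
    obtain ⟨r, hr, rfl⟩ := Finset.mem_image.1 hq
    have := hy r hr
    simpa [negPair] using this
  · intro z hz
    rw [sp_neg, neg_neg] at hz
    have := hd _ hz
    simpa [Polynomial.derivative_comp] using this
  · intro z hz
    rw [sp_neg, neg_neg] at hz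
    have := hd' _ hz
    simpa [Polynomial.derivative_comp] using this
  · intro q hq
    obtain ⟨r, hr, rfl⟩ := Finset.mem_image.1 hq
    simpa [negPair] using hend r hr
  · simpa using hpos
theorem sp_trans3 {f : Finset (ℝ × ℝ)} {w y z y' : ℝ} (h1 : SP f w y') (h2 : SP f y y')
    (h3 : SP f y z) : SP f w z := fun q hq =>
  ⟨((h1 q hq).1.trans (h2 q hq).1.symm).trans (h3 q hq).1,
    ((h1 q hq).2.trans (h2 q hq).2.symm).trans (h3 q hq).2⟩

theorem sp_open {f : Finset (ℝ × ℝ)} {y : ℝ} (hy : ∀ q ∈ f, q.1 ≠ y) :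
    ∀ᶠ z in 𝓝 y, ∀ y', SP f y y' → SP f z y' := by
  have h : ∀ q ∈ f, ∀ᶠ z in 𝓝 y, (q.1 < y ↔ q.1 < z) ∧ (y < q.1 ↔ z < q.1) := by
    intro q hq
    rcases lt_or_gt_of_ne (hy q hq) with h | h
    · filter_upwards [lt_mem_nhds h] with z hz
      exact ⟨iff_of_true h hz, iff_of_false h.not_gt (not_lt.2 (le_of_lt hz))⟩
    · filter_upwards [gt_mem_nhds h] with z hz
      exact ⟨iff_of_false h.not_gt (not_lt.2 (le_of_lt hz)), iff_of_true h hz⟩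
  have h2 := (Filter.eventually_all_finset f).2 h
  filter_upwards [h2] with z hz y' hs q hq
  exact ⟨(hz q hq).1.symm.trans (hs q hq).1, (hz q hq).2.symm.trans (hs q hq).2⟩

theorem poly_zero_of_eventually {Q : Polynomial ℝ} {y : ℝ} (h : ∀ᶠ z in 𝓝 y, Q.eval z = 0) :
    Q = 0 := by
  apply Polynomial.eq_zero_of_infinite_isRoot
  exact infinite_of_mem_nhds y h

/-- roots of matched nonzero polynomials belong to the matching -/
theorem root_mem {f : Finset (ℝ × ℝ)} (hf : PIso f) {Q Q' : Polynomial ℝ} (hQ : Q ≠ 0)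
    (hm : ∀ y y', SP f y y' → SignType.sign (Q.eval y) = SignType.sign (Q'.eval y'))
    {z : ℝ} (hz : Q.eval z = 0) : ∃ z', (z, z') ∈ f := by
  by_contra hcon
  have hy : ∀ q ∈ f, q.1 ≠ z := by
    rintro q hq rfl
    exact hcon ⟨q.2, hq⟩
  obtain ⟨z', hz'⟩ := hf.across z
  apply hQ
  apply poly_zero_of_eventually (y := z)
  filter_upwards [sp_open hy] with w hw
  have h1 := hm w z' (hw z' hz')
  rw [← hm z z' hz', hz, sign_zero, sign_eq_zero_iff] at h1
  exact h1

structure Hyp (f : Finset (ℝ × ℝ)) (p p' : Polynomial ℝ) : Prop where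
  iso : PIso f
  ne : p.derivative ≠ 0
  ne' : p'.derivative ≠ 0
  der : ∀ y y', SP f y y' →
    SignType.sign (p.derivative.eval y) = SignType.sign (p'.derivative.eval y')
  pt : ∀ q ∈ f, SignType.sign (p.eval q.1) = SignType.sign (p'.eval q.2)

theorem Hyp.swap {f : Finset (ℝ × ℝ)} {p p' : Polynomial ℝ} (h : Hyp f p p') :
    Hyp (f.image Prod.swap) p' p where
  iso := h.iso.swap
  ne := h.ne'
  ne' := h.ne
  der := fun y y' hs => (h.der y' y (sp_swap.1 hs)).symm
  pt := by
    intro q hq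
    obtain ⟨r, hr, rfl⟩ := Finset.mem_image.1 hq
    exact (h.pt r hr).symm

theorem Hyp.neg {f : Finset (ℝ × ℝ)} {p p' : Polynomial ℝ} (h : Hyp f p p') :
    Hyp f (-p) (-p') where
  iso := h.iso
  ne := by simpa using h.ne
  ne' := by simpa using h.ne'
  der := by
    intro y y' hs
    have := h.der y y' hs
    simp only [Polynomial.derivative_neg, Polynomial.eval_neg, Left.sign_neg, this]
  pt := by
    intro q hq
    simp only [Polynomial.eval_neg, Left.sign_neg, h.pt q hq]

theorem Hyp.der_ne {f : Finset (ℝ × ℝ)} {p p' : Polynomial ℝ} (h : Hyp f p p') {y : ℝ}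
    (hy : ∀ q ∈ f, q.1 ≠ y) : p.derivative.eval y ≠ 0 := by
  intro h0
  obtain ⟨z, hz⟩ := root_mem h.iso h.ne h.der h0
  exact hy _ hz rfl

theorem fst_ne_swap {f : Finset (ℝ × ℝ)} {y y' : ℝ} (hsp : SP f y y') (hy : ∀ q ∈ f, q.1 ≠ y) :
    ∀ q ∈ f.image Prod.swap, q.1 ≠ y' := by
  intro q hq h
  obtain ⟨r, hr, rfl⟩ := Finset.mem_image.1 hq
  simp only [Prod.fst_swap] at h
  apply hy r hr
  have := hsp r hr
  rw [h] at this
  simp only [lt_self_iff_false, iff_false, not_lt] at this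
  exact le_antisymm this.2 this.1

theorem Hyp.key {f : Finset (ℝ × ℝ)} {p p' : Polynomial ℝ} (h : Hyp f p p') {y y' : ℝ}
    (hsp : SP f y y') (hy : ∀ q ∈ f, q.1 ≠ y) (hpos : 0 < p.eval y) :
    ∃ z, SP f y z ∧ 0 < p'.eval z := by
  have hne := h.der_ne hy
  rcases lt_or_gt_of_ne hne with hn | hn
  · refine key_neg h.iso hsp hy ?_ ?_ h.pt hpos
    · intro z hz
      have := h.der z y' hz
      rw [← h.der y y' hsp, sign_neg hn, sign_eq_neg_one_iff] at this
      exact this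
    · intro z hz
      have := h.der y z hz
      rw [sign_neg hn, eq_comm, sign_eq_neg_one_iff] at this
      exact this
  · refine key_pos h.iso hsp hy ?_ ?_ h.pt hpos
    · intro z hz
      have := h.der z y' hz
      rw [← h.der y y' hsp, sign_pos hn, sign_eq_one_iff] at this
      exact this
    · intro z hz
      have := h.der y z hz
      rw [sign_pos hn, eq_comm, sign_eq_one_iff] at this
      exact this

theorem sp_conn {f : Finset (ℝ × ℝ)} {y' : ℝ} : OrdConnected {z | SP f z y'} := by
  constructor
  intro a ha b hb z hz q hq
  have h1 := ha q hq
  have h2 := hb q hq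
  refine ⟨⟨fun h => h2.1.1 (h.trans_le hz.2), fun h => (h1.1.2 h).trans_le hz.1⟩,
    ⟨fun h => h1.2.1 (hz.1.trans_lt h), fun h => hz.2.trans_lt (h2.2.2 h)⟩⟩

theorem sp_conn' {f : Finset (ℝ × ℝ)} {y : ℝ} : OrdConnected {z | SP f y z} := by
  have := sp_conn (f := f.image Prod.swap) (y' := y)
  simpa only [sp_swap] using this

theorem Hyp.fin_aux {f : Finset (ℝ × ℝ)} {p p' : Polynomial ℝ} (h : Hyp f p p') {y y' : ℝ}
    (hsp : SP f y y') (hy : ∀ q ∈ f, q.1 ≠ y)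
    (hg : ∀ w z, p.eval w = 0 → p'.eval z = 0 → SP f w z →
      ((w < y ↔ z < y') ∧ (y < w ↔ y' < z)))
    (hpos : 0 < p.eval y) : 0 < p'.eval y' := by
  by_contra hcon
  rw [not_lt] at hcon
  have hy' := fst_ne_swap hsp hy
  have hsub : ∀ {w z}, SP f w y' → SP f y z → SP f w z := by
    intro w z h1 h2
    exact sp_trans3 h1 hsp h2
  obtain ⟨z, hz, hpz⟩ := h.key hsp hy hpos
  -- monotonicity
  have hmono : (StrictMonoOn (fun z => p.eval z) {w | SP f w y'} ∧
      StrictMonoOn (fun z => p'.eval z) {z | SP f y z}) ∨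
      (StrictAntiOn (fun z => p.eval z) {w | SP f w y'} ∧
      StrictAntiOn (fun z => p'.eval z) {z | SP f y z}) := by
    rcases lt_or_gt_of_ne (h.der_ne hy) with hn | hn
    · right
      constructor
      · apply strictAntiOn_of_deriv_neg sp_conn.convex p.continuous.continuousOn
        intro w hw
        rw [Polynomial.deriv]
        have := h.der w y' (interior_subset hw)
        rw [← h.der y y' hsp, sign_neg hn, sign_eq_neg_one_iff] at this
        exact this
      · apply strictAntiOn_of_deriv_neg sp_conn'.convex p'.continuous.continuousOn
        intro w hw
        rw [Polynomial.deriv]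
        have := h.der y w (interior_subset hw)
        rw [sign_neg hn, eq_comm, sign_eq_neg_one_iff] at this
        exact this
    · left
      constructor
      · apply strictMonoOn_of_deriv_pos sp_conn.convex p.continuous.continuousOn
        intro w hw
        rw [Polynomial.deriv]
        have := h.der w y' (interior_subset hw)
        rw [← h.der y y' hsp, sign_pos hn, sign_eq_one_iff] at this
        exact this
      · apply strictMonoOn_of_deriv_pos sp_conn'.convex p'.continuous.continuousOn
        intro w hw
        rw [Polynomial.deriv]
        have := h.der y w (interior_subset hw)
        rw [sign_pos hn, eq_comm, sign_eq_one_iff] at this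
        exact this
  have hnb : ∀ᶠ u in 𝓝 y', SP f y u := by
    filter_upwards [sp_open hy'] with u hu
    exact sp_swap.1 (hu y (sp_swap.2 hsp))
  have hlt : ∃ u, SP f y u ∧ p'.eval u < 0 := by
    rcases hmono with ⟨_, hm⟩ | ⟨_, hm⟩
    · obtain ⟨u, hu1, hu2⟩ := ((hnb.filter_mono nhdsWithin_le_nhds).and
        (self_mem_nhdsWithin : Iio y' ∈ 𝓝[<] y')).exists
      exact ⟨u, hu1, (hm hu1 hsp hu2).trans_le hcon⟩
    · obtain ⟨u, hu1, hu2⟩ := ((hnb.filter_mono nhdsWithin_le_nhds).and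
        (self_mem_nhdsWithin : Ioi y' ∈ 𝓝[>] y')).exists
      exact ⟨u, hu1, (hm hsp hu1 hu2).trans_le hcon⟩
  obtain ⟨u, hu, hpu⟩ := hlt
  have hw : ∃ w, SP f w y' ∧ p.eval w < 0 := by
    have hu' := hu
    obtain ⟨w, hw1, hw2⟩ := h.swap.neg.key (y := u) (y' := y) (sp_swap.2 hu)
      (fst_ne_swap hu hy) (by simpa using hpu)
    rw [sp_swap] at hw1
    refine ⟨w, ?_, by simpa using hw2⟩
    exact sp_trans3 hw1 hu hsp
  obtain ⟨w, hw, hpw⟩ := hw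
  obtain ⟨w0, hw0, hpw0⟩ : ∃ w0, SP f w0 y' ∧ p.eval w0 = 0 := by
    have := sp_conn.isPreconnected.image _ (p.continuous.continuousOn (s := {w | SP f w y'}))
    have := this.ordConnected.out ⟨w, hw, rfl⟩ ⟨y, hsp, rfl⟩ ⟨hpw.le, hpos.le⟩
    obtain ⟨w0, h1, h2⟩ := this
    exact ⟨w0, h1, h2⟩
  obtain ⟨z0, hz0, hpz0⟩ : ∃ z0, SP f y z0 ∧ p'.eval z0 = 0 := by
    have := sp_conn'.isPreconnected.image _ (p'.continuous.continuousOn (s := {z | SP f y z}))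
    have := this.ordConnected.out ⟨u, hu, rfl⟩ ⟨z, hz, rfl⟩ ⟨hpu.le, hpz.le⟩
    obtain ⟨w0, h1, h2⟩ := this
    exact ⟨w0, h1, h2⟩
  have hcmp := hg w0 z0 hpw0 hpz0 (hsub hw0 hz0)
  rcases hmono with ⟨hm, hm'⟩ | ⟨hm, hm'⟩
  · have h1 : w0 < y := (hm.lt_iff_lt hw0 hsp).1 (by simpa only [hpw0] using hpos)
    have h2 := hm' hz0 hsp (hcmp.1.1 h1)
    simp only [hpz0] at h2
    exact absurd h2 (not_lt.2 hcon)
  · have h1 : y < w0 := (hm.lt_iff_gt hw0 hsp).1 (by simpa only [hpw0] using hpos)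
    have h2 := hm' hsp hz0 (hcmp.2.1 h1)
    simp only [hpz0] at h2
    exact absurd h2 (not_lt.2 hcon)

open Classical in
theorem Hyp.extend {f : Finset (ℝ × ℝ)} {p p' : Polynomial ℝ} (h : Hyp f p p') :
    ∃ g, f ⊆ g ∧ PIso g ∧ (∀ q ∈ g, q ∈ f ∨ p.eval q.1 = 0) ∧
      ∀ y y', SP g y y' → SignType.sign (p.eval y) = SignType.sign (p'.eval y') := by
  have hp0 : p ≠ 0 := by rintro rfl; exact h.ne (by simp)
  have hp0' : p' ≠ 0 := by rintro rfl; exact h.ne' (by simp)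
  let N := (p.roots.toFinset ×ˢ p'.roots.toFinset).filter (fun q => SP f q.1 q.2)
  have hN : ∀ w z, (w, z) ∈ N ↔ (p.eval w = 0 ∧ p'.eval z = 0) ∧ SP f w z := by
    intro w z
    simp [N, hp0, hp0', Polynomial.IsRoot]
  have rolle : ∀ {f : Finset (ℝ × ℝ)} {p p' : Polynomial ℝ}, Hyp f p p' → ∀ {w1 w2 : ℝ},
      p.eval w1 = 0 → p.eval w2 = 0 → w1 < w2 → ∃ q ∈ f, w1 < q.1 ∧ q.1 < w2 := by
    intro f p p' h w1 w2 h1 h2 hlt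
    obtain ⟨c, hc, hc2⟩ := exists_deriv_eq_zero hlt (p.continuous.continuousOn) (h1.trans h2.symm)
    rw [Polynomial.deriv] at hc2
    obtain ⟨c', hc'⟩ := root_mem h.iso h.ne h.der hc2
    exact ⟨_, hc', hc⟩
  have hlt : ∀ w1 z1 w2 z2, (w1, z1) ∈ N → (w2, z2) ∈ N → (w1 < w2 ↔ z1 < z2) := by
    intro w1 z1 w2 z2 h1 h2
    rw [hN] at h1 h2
    constructor
    · intro hl
      obtain ⟨q, hq, ha, hb⟩ := rolle h h1.1.1 h2.1.1 hl
      exact ((h1.2 q hq).2.1 ha).trans ((h2.2 q hq).1.1 hb)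
    · intro hl
      obtain ⟨q, hq, ha, hb⟩ := rolle h.swap h1.1.2 h2.1.2 hl
      obtain ⟨r, hr, rfl⟩ := Finset.mem_image.1 hq
      exact ((h1.2 r hr).2.2 ha).trans ((h2.2 r hr).1.2 hb)
  refine ⟨f ∪ N, Finset.subset_union_left, ?_, ?_, ?_⟩
  · intro a ha b hb
    rcases Finset.mem_union.1 ha with ha | ha <;> rcases Finset.mem_union.1 hb with hb | hb
    · exact h.iso a ha b hb
    · have := ((hN b.1 b.2).1 hb).2 a ha
      exact ⟨this.2.symm.symm, this.1⟩
    · exact ((hN a.1 a.2).1 ha).2 b hb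
    · exact ⟨hlt _ _ _ _ hb ha, hlt _ _ _ _ ha hb⟩
  · intro q hq
    rcases Finset.mem_union.1 hq with hq | hq
    · exact Or.inl hq
    · exact Or.inr ((hN q.1 q.2).1 hq).1.1
  · intro y y' hg
    have hsp : SP f y y' := fun q hq => hg q (Finset.mem_union_left _ hq)
    by_cases hy : ∃ q ∈ f, q.1 = y
    · obtain ⟨q, hq, rfl⟩ := hy
      rw [hsp.eq_right (z := q.2) hq]
      exact h.pt q hq
    · push Not at hy
      have hgg : ∀ w z, p.eval w = 0 → p'.eval z = 0 → SP f w z →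
          ((w < y ↔ z < y') ∧ (y < w ↔ y' < z)) := fun w z h1 h2 h3 =>
        hg (w, z) (Finset.mem_union_right _ ((hN w z).2 ⟨⟨h1, h2⟩, h3⟩))
      have hgg' : ∀ w z, p'.eval w = 0 → p.eval z = 0 → SP (f.image Prod.swap) w z →
          ((w < y' ↔ z < y) ∧ (y' < w ↔ y < z)) := fun w z h1 h2 h3 =>
        ⟨(hgg z w h2 h1 (sp_swap.1 h3)).1.symm, (hgg z w h2 h1 (sp_swap.1 h3)).2.symm⟩
      have e1 : 0 < p.eval y ↔ 0 < p'.eval y' :=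
        ⟨h.fin_aux hsp hy hgg, h.swap.fin_aux (sp_swap.2 hsp) (fst_ne_swap hsp hy) hgg'⟩
      have e2 : 0 < (-p).eval y ↔ 0 < (-p').eval y' :=
        ⟨h.neg.fin_aux hsp hy (by simpa using hgg),
          h.swap.neg.fin_aux (sp_swap.2 hsp) (fst_ne_swap hsp hy) (by simpa using hgg')⟩
      simp only [Polynomial.eval_neg, Left.neg_pos_iff] at e2
      rcases lt_trichotomy (p.eval y) 0 with h1 | h1 | h1
      · rw [sign_neg h1, sign_neg (e2.1 h1)]
      · have : p'.eval y' = 0 := by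
          apply le_antisymm
          · rw [← not_lt, ← e1, h1]; simp
          · rw [← not_lt, ← e2, h1]; simp
        rw [h1, this]
      · rw [sign_pos h1, sign_pos (e1.1 h1)]
/-! ### Elimination of one variable -/

theorem fin_closure {α : Type*} [DecidableEq α] (deg : α → ℕ) (G : α → α → Finset α)
    (hG : ∀ p q, 1 ≤ deg q → deg q ≤ deg p → ∀ r ∈ G p q, deg r < deg q) (S : Finset α) :
    ∃ T, S ⊆ T ∧ ∀ p ∈ T, ∀ q ∈ T, 1 ≤ deg q → deg q ≤ deg p → G p q ⊆ T := by
  obtain ⟨D, hD⟩ : ∃ D, ∀ p ∈ S, deg p < D := by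
    refine ⟨S.sup deg + 1, fun p hp => Nat.lt_succ_of_le (Finset.le_sup hp)⟩
  have key : ∀ n ≤ D, ∃ T, S ⊆ T ∧ (∀ p ∈ T, deg p < D) ∧
      ∀ p ∈ T, ∀ q ∈ T, 1 ≤ deg q → D - n ≤ deg q → deg q ≤ deg p → G p q ⊆ T := by
    intro n
    induction n with
    | zero =>
      intro _
      refine ⟨S, subset_rfl, hD, ?_⟩
      intro p _ q hq _ h2
      have := hD q hq
      omega
    | succ n ih =>
      intro hn
      obtain ⟨T, hT1, hT2, hT3⟩ := ih (by omega)
      let P := (T ×ˢ T).filter (fun x => 1 ≤ deg x.2 ∧ deg x.2 = D - (n + 1) ∧ deg x.2 ≤ deg x.1)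
      let T' := T ∪ P.biUnion (fun x => G x.1 x.2)
      have hnew : ∀ r ∈ T', r ∈ T ∨ deg r < D - (n + 1) := by
        intro r hr
        rcases Finset.mem_union.1 hr with hr | hr
        · exact Or.inl hr
        · right
          obtain ⟨x, hx, hrx⟩ := Finset.mem_biUnion.1 hr
          have hx := (Finset.mem_filter.1 hx).2
          have := hG x.1 x.2 hx.1 hx.2.2 r hrx
          omega
      refine ⟨T', hT1.trans Finset.subset_union_left, ?_, ?_⟩
      · intro p hp
        rcases hnew p hp with h | h
        · exact hT2 p h
        · omega
      · intro p hp q hq h1 h2 h3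
        have hqT : q ∈ T := (hnew q hq).resolve_right (by omega)
        have hpT : p ∈ T := (hnew p hp).resolve_right (by omega)
        by_cases h4 : D - n ≤ deg q
        · exact (hT3 p hpT q hqT h1 h4 h3).trans Finset.subset_union_left
        · intro r hr
          apply Finset.mem_union_right
          refine Finset.mem_biUnion.2 ⟨(p, q), Finset.mem_filter.2
            ⟨Finset.mem_product.2 ⟨hpT, hqT⟩, h1, ?_, h3⟩, hr⟩
          show deg q = D - (n + 1)
          omega
  obtain ⟨T, h1, _, h3⟩ := key D le_rfl
  exact ⟨T, h1, fun p hp q hq hh => h3 p hp q hq hh (by omega)⟩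

open Polynomial in
theorem exists_prem {R : Type*} [CommRing R] (q : R[X]) (hq : 1 ≤ q.natDegree) (p : R[X]) :
    ∃ (k : ℕ) (h r : R[X]), C q.leadingCoeff ^ k * p = q * h + r ∧ r.natDegree < q.natDegree := by
  suffices H : ∀ n, ∀ p : R[X], p.natDegree ≤ n → ∃ (k : ℕ) (h r : R[X]),
      C q.leadingCoeff ^ k * p = q * h + r ∧ r.natDegree < q.natDegree from H _ p le_rfl
  intro n
  induction n with
  | zero =>
    intro p hp
    exact ⟨0, 0, p, by simp, by omega⟩
  | succ n ih =>
    intro p hp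
    by_cases hlt : p.natDegree < q.natDegree
    · exact ⟨0, 0, p, by simp, hlt⟩
    · rw [not_lt] at hlt
      have hdeg : (C q.leadingCoeff * p - C p.leadingCoeff * X ^ (p.natDegree - q.natDegree) * q).natDegree
          ≤ n := by
        have h1 : (C q.leadingCoeff * p -
            C p.leadingCoeff * X ^ (p.natDegree - q.natDegree) * q).natDegree ≤ p.natDegree := by
          refine (natDegree_sub_le _ _).trans (max_le (natDegree_C_mul_le _ _) ?_)
          refine natDegree_mul_le.trans ?_
          have := natDegree_C_mul_X_pow_le p.leadingCoeff (p.natDegree - q.natDegree)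
          omega
        have h2 := natDegree_le_pred h1 (by
          have e : p.natDegree - (p.natDegree - q.natDegree) = q.natDegree := by omega
          rw [coeff_sub, coeff_C_mul, mul_assoc, coeff_C_mul, coeff_X_pow_mul',
            if_pos (Nat.sub_le _ _), e]
          simp only [coeff_natDegree]
          ring)
        omega
      obtain ⟨k, h, r, e, hr⟩ := ih _ hdeg
      refine ⟨k + 1, h + C q.leadingCoeff ^ k *
        (C p.leadingCoeff * X ^ (p.natDegree - q.natDegree)), r, ?_, hr⟩
      calc C q.leadingCoeff ^ (k + 1) * p = C q.leadingCoeff ^ k * (C q.leadingCoeff * p -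
            C p.leadingCoeff * X ^ (p.natDegree - q.natDegree) * q) + C q.leadingCoeff ^ k *
            (C p.leadingCoeff * X ^ (p.natDegree - q.natDegree)) * q := by ring
        _ = _ := by rw [e]; ring

open Classical in
def prem {R : Type*} [CommRing R] (p q : Polynomial R) : Polynomial R :=
  if hq : 1 ≤ q.natDegree then (exists_prem q hq p).choose_spec.choose_spec.choose else 0

open Polynomial in
theorem prem_spec {R : Type*} [CommRing R] (p q : R[X]) (hq : 1 ≤ q.natDegree) :
    (∃ (k : ℕ) (h : R[X]), C q.leadingCoeff ^ k * p = q * h + prem p q) ∧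
      (prem p q).natDegree < q.natDegree := by
  rw [prem, dif_pos hq]
  have := (exists_prem q hq p).choose_spec.choose_spec.choose_spec
  exact ⟨⟨_, _, this.1⟩, this.2⟩

open Classical in
def elimOps {R : Type*} [CommRing R] (p q : Polynomial R) : Finset (Polynomial R) :=
  {q.eraseLead, Polynomial.derivative q, Polynomial.C q.leadingCoeff, prem p q}

structure EClosed {R : Type*} [CommRing R] (T : Finset (Polynomial R)) : Prop where
  el : ∀ p ∈ T, 1 ≤ p.natDegree → p.eraseLead ∈ T
  der : ∀ p ∈ T, 1 ≤ p.natDegree → Polynomial.derivative p ∈ T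
  lc : ∀ p ∈ T, 1 ≤ p.natDegree → Polynomial.C p.leadingCoeff ∈ T
  rem : ∀ p ∈ T, ∀ q ∈ T, 1 ≤ q.natDegree → q.natDegree ≤ p.natDegree → prem p q ∈ T

open Classical in
theorem exists_eclosed {R : Type*} [CommRing R] (S : Finset (Polynomial R)) :
    ∃ T, S ⊆ T ∧ EClosed T := by
  obtain ⟨T, h1, h2⟩ := fin_closure (fun p : Polynomial R => p.natDegree) elimOps (by
    intro p q h1 _ r hr
    simp only [elimOps, Finset.mem_insert, Finset.mem_singleton] at hr
    rcases hr with rfl | rfl | rfl | rfl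
    · have := q.eraseLead_natDegree_le
      show _ < _
      omega
    · have := q.natDegree_derivative_le
      show _ < _
      omega
    · show _ < _
      rw [Polynomial.natDegree_C]
      omega
    · exact (prem_spec p q h1).2) S
  refine ⟨T, h1, ⟨?_, ?_, ?_, ?_⟩⟩
  · intro p hp h
    exact h2 p hp p hp h le_rfl (by simp [elimOps])
  · intro p hp h
    exact h2 p hp p hp h le_rfl (by simp [elimOps])
  · intro p hp h
    exact h2 p hp p hp h le_rfl (by simp [elimOps])
  · intro p hp q hq h h'
    exact h2 p hp q hq h h' (by simp [elimOps])

section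
variable {R : Type*} [CommRing R] {ε ε' : R →+* ℝ} {T : Finset (Polynomial R)}

open Polynomial in
theorem trunc (hT : EClosed T)
    (hs : ∀ c, C c ∈ T → SignType.sign (ε c) = SignType.sign (ε' c)) :
    ∀ n, ∀ p ∈ T, p.natDegree ≤ n → (p.map ε = 0 ∧ p.map ε' = 0) ∨
      ∃ r ∈ T, r.natDegree ≤ p.natDegree ∧ ε r.leadingCoeff ≠ 0 ∧ r.map ε = p.map ε ∧
        r.map ε' = p.map ε' := by
  have hz : ∀ c, C c ∈ T → ε c = 0 → ε' c = 0 := by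
    intro c hc h0
    have := hs c hc
    rw [h0, sign_zero, eq_comm, sign_eq_zero_iff] at this
    exact this
  have h00 : ∀ p ∈ T, p.natDegree = 0 → (p.map ε = 0 ∧ p.map ε' = 0) ∨
      ∃ r ∈ T, r.natDegree ≤ p.natDegree ∧ ε r.leadingCoeff ≠ 0 ∧ r.map ε = p.map ε ∧
        r.map ε' = p.map ε' := by
    intro p hp h0
    by_cases hl : ε p.leadingCoeff = 0
    · left
      have hpc := eq_C_of_natDegree_eq_zero h0
      rw [leadingCoeff, h0] at hl
      have hpT : C (p.coeff 0) ∈ T := hpc ▸ hp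
      have := hz _ hpT hl
      rw [hpc, map_C, map_C, hl, this]
      simp
    · exact Or.inr ⟨p, hp, le_rfl, hl, rfl, rfl⟩
  intro n
  induction n with
  | zero =>
    intro p hp hn
    exact h00 p hp (by omega)
  | succ n ih =>
    intro p hp hn
    by_cases h0 : p.natDegree = 0
    · exact h00 p hp h0
    by_cases hl : ε p.leadingCoeff = 0
    · have hl' := hz _ (hT.lc p hp (by omega)) hl
      have hle := p.eraseLead_natDegree_le
      have e1 : p.eraseLead.map ε = p.map ε := by
        have := congrArg (Polynomial.map ε) p.eraseLead_add_C_mul_X_pow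
        rw [Polynomial.map_add, Polynomial.map_mul, map_C, hl, C_0, zero_mul, add_zero] at this
        exact this
      have e2 : p.eraseLead.map ε' = p.map ε' := by
        have := congrArg (Polynomial.map ε') p.eraseLead_add_C_mul_X_pow
        rw [Polynomial.map_add, Polynomial.map_mul, map_C, hl', C_0, zero_mul, add_zero] at this
        exact this
      have := ih _ (hT.el p hp (by omega)) (by omega)
      rw [e1, e2] at this
      rcases this with h | ⟨r, h1, h2, h3⟩
      · exact Or.inl h
      · exact Or.inr ⟨r, h1, by omega, h3⟩
    · exact Or.inr ⟨p, hp, le_rfl, hl, rfl, rfl⟩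

open Polynomial in
theorem elim_match (hT : EClosed T)
    (hs : ∀ c, C c ∈ T → SignType.sign (ε c) = SignType.sign (ε' c)) :
    ∃ f, PIso f ∧ ∀ p ∈ T, ∀ y y', SP f y y' →
      SignType.sign ((p.map ε).eval y) = SignType.sign ((p.map ε').eval y') := by
  classical
  let A := T.filter (fun p => ε p.leadingCoeff ≠ 0)
  have hA : ∀ p, p ∈ A ↔ p ∈ T ∧ ε p.leadingCoeff ≠ 0 := by intro p; simp [A]
  have hlc : ∀ p ∈ T, SignType.sign (ε p.leadingCoeff) = SignType.sign (ε' p.leadingCoeff) := by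
    intro p hp
    by_cases h0 : p.natDegree = 0
    · apply hs
      rw [leadingCoeff, h0, ← eq_C_of_natDegree_eq_zero h0]
      exact hp
    · exact hs _ (hT.lc p hp (by omega))
  have hlc' : ∀ p ∈ A, ε' p.leadingCoeff ≠ 0 := by
    intro p hp h0
    have := hlc p ((hA p).1 hp).1
    rw [h0, sign_zero, sign_eq_zero_iff] at this
    exact ((hA p).1 hp).2 this
  have main : ∀ s : Finset R[X], s ⊆ A →
      (∀ q ∈ A, ∀ b ∈ s, q.natDegree < b.natDegree → q ∈ s) →
      ∃ f, PIso f ∧ (∀ p ∈ s, ∀ y y', SP f y y' →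
        SignType.sign ((p.map ε).eval y) = SignType.sign ((p.map ε').eval y')) ∧
        ∀ q ∈ f, ∃ p ∈ s, (p.map ε).eval q.1 = 0 := by
    intro s
    induction s using Finset.induction_on_max_value (fun p : R[X] => p.natDegree) with
    | empty =>
      intro _ _
      exact ⟨∅, by simp [PIso], by simp, by simp⟩
    | insert a s has hmax ih =>
      intro hsA hdown
      have haA := hsA (Finset.mem_insert_self a s)
      obtain ⟨haT, hale⟩ := (hA a).1 haA
      obtain ⟨f, hf1, hf2, hf3⟩ := ih ((Finset.subset_insert a s).trans hsA) (by
        intro q hq b hb hlt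
        have h1 := hdown q hq b (Finset.mem_insert_of_mem hb) hlt
        rcases Finset.mem_insert.1 h1 with rfl | h1
        · have h3 : b.natDegree ≤ q.natDegree := hmax b hb
          omega
        · exact h1)
      have hlow : ∀ q ∈ A, q.natDegree < a.natDegree → q ∈ s := by
        intro q hq hlt
        rcases Finset.mem_insert.1 (hdown q hq a (Finset.mem_insert_self a s) hlt) with rfl | h1
        · omega
        · exact h1
      -- matching for low degree members of T
      have hlowT : ∀ p ∈ T, p.natDegree < a.natDegree → ∀ y y', SP f y y' →
          SignType.sign ((p.map ε).eval y) = SignType.sign ((p.map ε').eval y') := by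
        intro p hp hlt y y' hy
        rcases trunc hT hs _ p hp le_rfl with ⟨h1, h2⟩ | ⟨r, h1, h2, h3, h4, h5⟩
        · rw [h1, h2]; simp
        · rw [← h4, ← h5]
          exact hf2 r (hlow r ((hA r).2 ⟨h1, h3⟩) (by omega)) y y' hy
      by_cases ha0 : a.natDegree = 0
      · refine ⟨f, hf1, ?_, ?_⟩
        · intro p hp y y' hy
          rcases Finset.mem_insert.1 hp with rfl | hp
          · have := hlc p haT
            rw [leadingCoeff, ha0] at this
            rw [eq_C_of_natDegree_eq_zero ha0]
            simpa using this
          · exact hf2 p hp y y' hy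
        · intro q hq
          obtain ⟨p, hp, h⟩ := hf3 q hq
          exact ⟨p, Finset.mem_insert_of_mem hp, h⟩
      · have hder : ∀ (δ : R →+* ℝ), δ a.leadingCoeff ≠ 0 → derivative (a.map δ) ≠ 0 := by
          intro δ hδ h0
          have h1 := Polynomial.derivative_eq_zero.1 h0
          rw [natDegree_map_of_leadingCoeff_ne_zero δ hδ] at h1
          exact ha0 h1
        have hyp : Hyp f (a.map ε) (a.map ε') := by
          refine ⟨hf1, hder ε hale, hder ε' (hlc' a haA), ?_, ?_⟩
          · intro y y' hy
            rw [derivative_map, derivative_map]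
            have := a.natDegree_derivative_le
            exact hlowT _ (hT.der a haT (by omega)) (by omega) y y' hy
          · intro q hq
            obtain ⟨b, hb, hroot⟩ := hf3 q hq
            have hbA := hsA (Finset.mem_insert_of_mem hb)
            obtain ⟨hbT, hble⟩ := (hA b).1 hbA
            have hb1 : 1 ≤ b.natDegree := by
              by_contra hcon
              have h0 : b.natDegree = 0 := by omega
              rw [eq_C_of_natDegree_eq_zero h0, map_C, eval_C] at hroot
              rw [leadingCoeff, h0] at hble
              exact hble hroot
            have hba : b.natDegree ≤ a.natDegree := hmax b hb
            have hroot' : (b.map ε').eval q.2 = 0 := by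
              have := hf2 b hb q.1 q.2 (hf1 q hq)
              rw [hroot, sign_zero, eq_comm, sign_eq_zero_iff] at this
              exact this
            obtain ⟨⟨k, h, e⟩, hrdeg⟩ := prem_spec a b hb1
            have hr := hlowT _ (hT.rem a haT b hbT hb1 hba) (by omega) q.1 q.2 (hf1 q hq)
            have e1 := congrArg (fun z => (z.map ε).eval q.1) e
            have e2 := congrArg (fun z => (z.map ε').eval q.2) e
            simp only [Polynomial.map_mul, Polynomial.map_pow, map_C, eval_mul, eval_pow, eval_C,
              Polynomial.map_add, eval_add, hroot, hroot', zero_mul, zero_add] at e1 e2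
            rw [← e1, ← e2, sign_mul, sign_mul, sign_pow, sign_pow, hlc b hbT] at hr
            refine mul_left_cancel₀ (pow_ne_zero k ?_) hr
            rw [Ne, sign_eq_zero_iff]
            exact hlc' b hbA
        obtain ⟨g, hg1, hg2, hg3, hg4⟩ := hyp.extend
        refine ⟨g, hg2, ?_, ?_⟩
        · intro p hp y y' hy
          rcases Finset.mem_insert.1 hp with rfl | hp
          · exact hg4 y y' hy
          · exact hf2 p hp y y' (fun q hq => hy q (hg1 hq))
        · intro q hq
          rcases hg3 q hq with h | h
          · obtain ⟨p, hp, h⟩ := hf3 q h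
            exact ⟨p, Finset.mem_insert_of_mem hp, h⟩
          · exact ⟨a, Finset.mem_insert_self a s, h⟩
  obtain ⟨f, hf1, hf2, _⟩ := main A subset_rfl (fun q hq _ _ _ => hq)
  refine ⟨f, hf1, ?_⟩
  intro p hp y y' hy
  rcases trunc hT hs _ p hp le_rfl with ⟨h1, h2⟩ | ⟨r, h1, h2, h3, h4, h5⟩
  · rw [h1, h2]; simp
  · rw [← h4, ← h5]
    exact hf2 r ((hA r).2 ⟨h1, h3⟩) y y' hy

end

open Classical in
theorem elim_main {R : Type*} [CommRing R] (S : Finset (Polynomial R)) :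
    ∃ K : Finset R, ∀ ε ε' : R →+* ℝ, (∀ c ∈ K, SignType.sign (ε c) = SignType.sign (ε' c)) →
      ∀ y, ∃ y', ∀ p ∈ S, SignType.sign ((p.map ε).eval y) = SignType.sign ((p.map ε').eval y') := by
  obtain ⟨T, hST, hT⟩ := exists_eclosed S
  refine ⟨T.image (fun p => p.coeff 0), fun ε ε' h y => ?_⟩
  obtain ⟨f, hf1, hf2⟩ := elim_match (ε := ε) (ε' := ε') hT (by
    intro c hc
    apply h
    exact Finset.mem_image.2 ⟨_, hc, by simp⟩)
  obtain ⟨y', hy'⟩ := hf1.across y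
  have hfin := fun p hp => hf2 p (hST hp) y y' hy'
  exact ⟨_, hfin⟩

/-! ### Semialgebraic sets: saturation, projection, calculus of definable predicates -/

theorem IsSA.sat {m : ℕ} {S : Set (Fin m → ℝ)} (h : IsSA S) :
    ∃ L : Finset (MvPolynomial (Fin m) ℝ), ∀ x x',
      (∀ p ∈ L, SignType.sign (MvPolynomial.eval x p) = SignType.sign (MvPolynomial.eval x' p)) →
      (x ∈ S ↔ x' ∈ S) := by
  classical
  induction h with
  | pos p =>
    refine ⟨{p}, fun x x' h => ?_⟩
    have := h p (Finset.mem_singleton_self p)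
    simp only [mem_ofPred_eq]
    rw [← sign_eq_one_iff, this, sign_eq_one_iff]
  | zero p =>
    refine ⟨{p}, fun x x' h => ?_⟩
    have := h p (Finset.mem_singleton_self p)
    simp only [mem_ofPred_eq]
    rw [← sign_eq_zero_iff, this, sign_eq_zero_iff]
  | union _ _ ih1 ih2 =>
    obtain ⟨L1, h1⟩ := ih1
    obtain ⟨L2, h2⟩ := ih2
    refine ⟨L1 ∪ L2, fun x x' h => ?_⟩
    exact or_congr (h1 x x' fun p hp => h p (Finset.mem_union_left _ hp))
      (h2 x x' fun p hp => h p (Finset.mem_union_right _ hp))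
  | compl _ ih =>
    obtain ⟨L, h1⟩ := ih
    exact ⟨L, fun x x' h => not_congr (h1 x x' h)⟩

theorem IsSA.empty {m : ℕ} : IsSA (∅ : Set (Fin m → ℝ)) := by
  have := IsSA.pos (0 : MvPolynomial (Fin m) ℝ)
  simpa using this

theorem IsSA.univ {m : ℕ} : IsSA (Set.univ : Set (Fin m → ℝ)) := by
  have := (IsSA.empty (m := m)).compl
  simpa using this

theorem IsSA.inter {m : ℕ} {S T : Set (Fin m → ℝ)} (hS : IsSA S) (hT : IsSA T) : IsSA (S ∩ T) := by
  have := (hS.compl.union hT.compl).compl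
  rwa [compl_union, compl_compl, compl_compl] at this

theorem IsSA.biUnion {m : ℕ} {ι : Type*} (s : Finset ι) (f : ι → Set (Fin m → ℝ))
    (h : ∀ i ∈ s, IsSA (f i)) : IsSA (⋃ i ∈ s, f i) := by
  classical
  induction s using Finset.induction_on with
  | empty => simpa using IsSA.empty
  | insert a s _ ih =>
    rw [Finset.set_biUnion_insert]
    exact (h a (Finset.mem_insert_self a s)).union
      (ih fun i hi => h i (Finset.mem_insert_of_mem hi))

theorem IsSA.biInter {m : ℕ} {ι : Type*} (s : Finset ι) (f : ι → Set (Fin m → ℝ))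
    (h : ∀ i ∈ s, IsSA (f i)) : IsSA (⋂ i ∈ s, f i) := by
  have := (IsSA.biUnion s (fun i => (f i)ᶜ) (fun i hi => (h i hi).compl)).compl
  simpa [compl_iUnion] using this

theorem isSA_sign {m : ℕ} (p : MvPolynomial (Fin m) ℝ) (σ : SignType) :
    IsSA {x | SignType.sign (MvPolynomial.eval x p) = σ} := by
  rcases σ with _ | _ | _
  · have := IsSA.zero p
    have e : {x | SignType.sign (MvPolynomial.eval x p) = SignType.zero} =
      {x | MvPolynomial.eval x p = 0} := by
      ext x; exact sign_eq_zero_iff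
    rw [e]; exact this
  · have := IsSA.pos (-p)
    have e : {x | SignType.sign (MvPolynomial.eval x p) = SignType.neg} =
      {x | 0 < MvPolynomial.eval x (-p)} := by
      ext x
      simp only [mem_ofPred_eq, map_neg, Left.neg_pos_iff]
      exact sign_eq_neg_one_iff
    rw [e]; exact this
  · have := IsSA.pos p
    have e : {x | SignType.sign (MvPolynomial.eval x p) = SignType.pos} =
      {x | 0 < MvPolynomial.eval x p} := by
      ext x; exact sign_eq_one_iff
    rw [e]; exact this

theorem isSA_of_sat {m : ℕ} {S : Set (Fin m → ℝ)} (L : Finset (MvPolynomial (Fin m) ℝ))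
    (hL : ∀ x x', (∀ p ∈ L, SignType.sign (MvPolynomial.eval x p) =
      SignType.sign (MvPolynomial.eval x' p)) → (x ∈ S → x' ∈ S)) : IsSA S := by
  classical
  let pat : (Fin m → ℝ) → (L → SignType) := fun x p => SignType.sign (MvPolynomial.eval x p.1)
  have e : S = ⋃ σ ∈ (Finset.univ.filter (fun σ : L → SignType => ∃ x ∈ S, pat x = σ)),
      ⋂ p ∈ (Finset.univ : Finset L), {x | SignType.sign (MvPolynomial.eval x p.1) = σ p} := by
    ext x
    simp only [Finset.mem_filter, Finset.mem_univ, true_and, mem_iUnion, mem_iInter,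
      mem_ofPred_eq, exists_prop, forall_const]
    constructor
    · intro hx
      exact ⟨pat x, ⟨x, hx, rfl⟩, fun p => rfl⟩
    · rintro ⟨_, ⟨y, hy, rfl⟩, h⟩
      exact hL y x (fun p hp => (h ⟨p, hp⟩).symm) hy
  rw [e]
  exact IsSA.biUnion _ _ fun σ _ => IsSA.biInter _ _ fun p _ => isSA_sign _ _

theorem IsSA.proj {m : ℕ} {S : Set (Fin (m + 1) → ℝ)} (h : IsSA S) :
    IsSA {x : Fin m → ℝ | ∃ y : ℝ, (Fin.cons y x : Fin (m + 1) → ℝ) ∈ S} := by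
  classical
  obtain ⟨L, hL⟩ := h.sat
  obtain ⟨K, hK⟩ := elim_main (L.image (MvPolynomial.finSuccEquiv ℝ m))
  refine isSA_of_sat K ?_
  rintro x x' hxx ⟨y, hy⟩
  obtain ⟨y', hy'⟩ := hK (MvPolynomial.eval x) (MvPolynomial.eval x') hxx y
  refine ⟨y', (hL _ _ ?_).1 hy⟩
  intro p hp
  rw [MvPolynomial.eval_eq_eval_mv_eval', MvPolynomial.eval_eq_eval_mv_eval']
  exact hy' _ (Finset.mem_image_of_mem _ hp)

theorem eval_bind {m n : ℕ} (x : Fin m → ℝ) (g : Fin n → MvPolynomial (Fin m) ℝ)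
    (p : MvPolynomial (Fin n) ℝ) : MvPolynomial.eval x (MvPolynomial.bind₁ g p) =
      MvPolynomial.eval (fun i => MvPolynomial.eval x (g i)) p := by
  induction p using MvPolynomial.induction_on with
  | C a => rw [MvPolynomial.bind₁_C_right, MvPolynomial.eval_C, MvPolynomial.eval_C]
  | add p q hp hq => rw [map_add, map_add, map_add, hp, hq]
  | mul_X p i hp => rw [map_mul, map_mul, map_mul, hp, MvPolynomial.bind₁_X_right,
      MvPolynomial.eval_X]

theorem IsSA.preim {m n : ℕ} {S : Set (Fin n → ℝ)} (h : IsSA S)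
    (g : Fin n → MvPolynomial (Fin m) ℝ) :
    IsSA {x : Fin m → ℝ | (fun i => MvPolynomial.eval x (g i)) ∈ S} := by
  induction h with
  | pos p =>
    have := IsSA.pos (MvPolynomial.bind₁ g p)
    simp only [eval_bind] at this
    exact this
  | zero p =>
    have := IsSA.zero (MvPolynomial.bind₁ g p)
    simp only [eval_bind] at this
    exact this
  | union _ _ ih1 ih2 => exact ih1.union ih2
  | compl _ ih => exact ih.compl

theorem pairEquiv_symm_castAdd {m n : ℕ} (x : Fin m → ℝ) (y : Fin n → ℝ) (i : Fin m) :
    (pairEquiv m n).symm (x, y) (Fin.castAdd n i) = x i := by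
  simp [pairEquiv, Equiv.arrowCongr, Equiv.sumArrowEquivProdArrow]

theorem pairEquiv_symm_natAdd {m n : ℕ} (x : Fin m → ℝ) (y : Fin n → ℝ) (i : Fin n) :
    (pairEquiv m n).symm (x, y) (Fin.natAdd m i) = y i := by
  simp [pairEquiv, Equiv.arrowCongr, Equiv.sumArrowEquivProdArrow]

theorem pairEquiv_fst {m n : ℕ} (z : Fin (m + n) → ℝ) (i : Fin m) :
    (pairEquiv m n z).1 i = z (Fin.castAdd n i) := by
  simp [pairEquiv, Equiv.arrowCongr, Equiv.sumArrowEquivProdArrow]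

theorem pairEquiv_snd {m n : ℕ} (z : Fin (m + n) → ℝ) (i : Fin n) :
    (pairEquiv m n z).2 i = z (Fin.natAdd m i) := by
  simp [pairEquiv, Equiv.arrowCongr, Equiv.sumArrowEquivProdArrow]

/-- Spaces with a fixed identification with some `ℝ^d`. -/
class PSp (E : Type) where
  dim : ℕ
  e : E ≃ (Fin dim → ℝ)

instance : PSp ℝ := ⟨1, (Equiv.funUnique (Fin 1) ℝ).symm⟩
instance (n : ℕ) : PSp (Fin n → ℝ) := ⟨n, Equiv.refl _⟩
instance (E F : Type) [PSp E] [PSp F] : PSp (E × F) :=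
  ⟨PSp.dim E + PSp.dim F, (Equiv.prodCongr PSp.e PSp.e).trans (pairEquiv _ _).symm⟩

/-- semialgebraic predicates -/
def SA {E : Type} [PSp E] (P : E → Prop) : Prop := IsSA {z | P (PSp.e.symm z)}
/-- polynomial functions -/
def PF {E : Type} [PSp E] (g : E → ℝ) : Prop :=
  ∃ p : MvPolynomial (Fin (PSp.dim E)) ℝ, ∀ x, g x = MvPolynomial.eval (PSp.e x) p
/-- polynomial maps -/
def PM {E F : Type} [PSp E] [PSp F] (g : E → F) : Prop := ∀ i, PF (fun x => PSp.e (g x) i)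

section PSpace
variable {E F G : Type} [PSp E] [PSp F] [PSp G]

theorem PF.const (c : ℝ) : PF (fun _ : E => c) := ⟨MvPolynomial.C c, by simp⟩
theorem PF.add {f g : E → ℝ} (hf : PF f) (hg : PF g) : PF (fun x => f x + g x) := by
  obtain ⟨p, hp⟩ := hf
  obtain ⟨q, hq⟩ := hg
  exact ⟨p + q, fun x => by simp [hp, hq]⟩
theorem PF.mul {f g : E → ℝ} (hf : PF f) (hg : PF g) : PF (fun x => f x * g x) := by
  obtain ⟨p, hp⟩ := hf
  obtain ⟨q, hq⟩ := hg
  exact ⟨p * q, fun x => by simp [hp, hq]⟩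
theorem PF.sub {f g : E → ℝ} (hf : PF f) (hg : PF g) : PF (fun x => f x - g x) := by
  obtain ⟨p, hp⟩ := hf
  obtain ⟨q, hq⟩ := hg
  exact ⟨p - q, fun x => by simp [hp, hq]⟩
theorem PF.pow {f : E → ℝ} (hf : PF f) (n : ℕ) : PF (fun x => f x ^ n) := by
  obtain ⟨p, hp⟩ := hf
  exact ⟨p ^ n, fun x => by simp [hp]⟩
theorem PF.sum {ι : Type*} {s : Finset ι} {f : ι → E → ℝ} (hf : ∀ i ∈ s, PF (f i)) :
    PF (fun x => ∑ i ∈ s, f i x) := by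
  choose! p hp using hf
  exact ⟨∑ i ∈ s, p i, fun x => by
    rw [map_sum]
    exact Finset.sum_congr rfl fun i hi => hp i hi x⟩

theorem PF.comp {g : F → ℝ} {h : E → F} (hg : PF g) (hh : PM h) : PF (fun x => g (h x)) := by
  obtain ⟨p, hp⟩ := hg
  choose q hq using hh
  refine ⟨MvPolynomial.bind₁ q p, fun x => ?_⟩
  show g (h x) = _
  rw [hp]
  have : PSp.e (h x) = fun i => MvPolynomial.eval (PSp.e x) (q i) := funext fun i => hq i x
  rw [this, eval_bind]

theorem PM.id : PM (fun x : E => x) := fun i => ⟨MvPolynomial.X i, fun x => by simp⟩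
theorem PM.comp {g : F → G} {h : E → F} (hg : PM g) (hh : PM h) : PM (fun x => g (h x)) :=
  fun i => (hg i).comp hh
theorem PM.fst {g : E → F × G} (hg : PM g) : PM (fun x => (g x).1) := by
  have : PM (fun z : F × G => z.1) := fun i => ⟨MvPolynomial.X (Fin.castAdd _ i), fun x => by
    rw [MvPolynomial.eval_X]
    exact (pairEquiv_symm_castAdd _ _ i).symm⟩
  exact this.comp hg
theorem PM.snd {g : E → F × G} (hg : PM g) : PM (fun x => (g x).2) := by
  have : PM (fun z : F × G => z.2) := fun i => ⟨MvPolynomial.X (Fin.natAdd _ i), fun x => by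
    rw [MvPolynomial.eval_X]
    exact (pairEquiv_symm_natAdd _ _ i).symm⟩
  exact this.comp hg
theorem PM.prodMk {g : E → F} {h : E → G} (hg : PM g) (hh : PM h) : PM (fun x => (g x, h x)) := by
  intro i
  refine Fin.addCases (fun i => ?_) (fun i => ?_) i
  · have : (fun x => PSp.e (g x, h x) (Fin.castAdd _ i)) = fun x => PSp.e (g x) i :=
      funext fun x => pairEquiv_symm_castAdd _ _ i
    rw [this]; exact hg i
  · have : (fun x => PSp.e (g x, h x) (Fin.natAdd _ i)) = fun x => PSp.e (h x) i :=
      funext fun x => pairEquiv_symm_natAdd _ _ i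
    rw [this]; exact hh i
theorem PF.toPM {g : E → ℝ} (hg : PF g) : PM g := fun _ => hg
theorem PM.toPF {g : E → ℝ} (hg : PM g) : PF g := hg 0
theorem PM.coord {n : ℕ} {g : E → Fin n → ℝ} (hg : PM g) (i : Fin n) : PF (fun x => g x i) := hg i
theorem PM.pi {n : ℕ} {g : E → Fin n → ℝ} (hg : ∀ i, PF (fun x => g x i)) : PM g := hg
theorem PM.e : PM (fun x : E => PSp.e x) := fun i => ⟨MvPolynomial.X i, fun x => by simp; rfl⟩
theorem PM.esymm : PM (fun z : Fin (PSp.dim E) → ℝ => (PSp.e.symm z : E)) :=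
  fun i => ⟨MvPolynomial.X i, fun x => by simp; rfl⟩

theorem SA.preim {P : F → Prop} (hP : SA P) {g : E → F} (hg : PM g) : SA (fun x => P (g x)) := by
  have hg' : PM (fun z : Fin (PSp.dim E) → ℝ => g (PSp.e.symm z)) := hg.comp PM.esymm
  choose q hq using hg'
  have := IsSA.preim hP q
  have e : {z : Fin (PSp.dim E) → ℝ | P (g (PSp.e.symm z))} = {z : Fin (PSp.dim E) → ℝ |
      (fun i => MvPolynomial.eval z (q i)) ∈ {z | P (PSp.e.symm z)}} := by
    ext z
    have h1 : (PSp.e.symm (fun i => MvPolynomial.eval z (q i)) : F) = g (PSp.e.symm z) := by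
      rw [Equiv.symm_apply_eq]
      exact (funext fun i => hq i z).symm
    show P (g (PSp.e.symm z)) ↔ P (PSp.e.symm (fun i => MvPolynomial.eval z (q i)))
    rw [h1]
  show IsSA {z : Fin (PSp.dim E) → ℝ | P (g (PSp.e.symm z))}
  rw [e]
  exact this

theorem SA.and {P Q : E → Prop} (hP : SA P) (hQ : SA Q) : SA (fun x => P x ∧ Q x) := hP.inter hQ
theorem SA.or {P Q : E → Prop} (hP : SA P) (hQ : SA Q) : SA (fun x => P x ∨ Q x) := hP.union hQ
theorem SA.not {P : E → Prop} (hP : SA P) : SA (fun x => ¬ P x) := hP.compl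
theorem SA.imp {P Q : E → Prop} (hP : SA P) (hQ : SA Q) : SA (fun x => P x → Q x) := by
  have := hP.not.or hQ
  simpa only [imp_iff_not_or] using this
theorem SA.pos {g : E → ℝ} (hg : PF g) : SA (fun x => 0 < g x) := by
  obtain ⟨p, hp⟩ := hg
  have := IsSA.pos p
  unfold SA
  simpa [hp] using this
theorem SA.zero {g : E → ℝ} (hg : PF g) : SA (fun x => g x = 0) := by
  obtain ⟨p, hp⟩ := hg
  have := IsSA.zero p
  unfold SA
  simpa [hp] using this
theorem SA.lt {f g : E → ℝ} (hf : PF f) (hg : PF g) : SA (fun x => f x < g x) := by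
  simpa only [sub_pos] using SA.pos (hg.sub hf)
theorem SA.eq {f g : E → ℝ} (hf : PF f) (hg : PF g) : SA (fun x => f x = g x) := by
  simpa only [sub_eq_zero] using SA.zero (hf.sub hg)
theorem SA.le {f g : E → ℝ} (hf : PF f) (hg : PF g) : SA (fun x => f x ≤ g x) := by
  simpa only [not_lt] using (SA.lt hg hf).not

theorem SA.exR {P : E → ℝ → Prop} (hP : SA (fun z : E × ℝ => P z.1 z.2)) :
    SA (fun x => ∃ y, P x y) := by
  have h1 : SA (fun w : Fin (PSp.dim E + 1) → ℝ => P (PSp.e.symm (Fin.tail w)) (w 0)) := by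
    have hm : PM (fun w : Fin (PSp.dim E + 1) → ℝ => ((PSp.e.symm (Fin.tail w) : E), w 0)) := by
      refine PM.prodMk (PM.esymm.comp ?_) (PM.id.coord 0).toPM
      exact PM.pi fun i => PM.id.coord i.succ
    exact hP.preim hm
  have h2 : IsSA {w : Fin (PSp.dim E + 1) → ℝ | P (PSp.e.symm (Fin.tail w)) (w 0)} := h1
  have h3 := h2.proj
  unfold SA
  simpa using h3

theorem SA.exFin {k : ℕ} : ∀ {E : Type} [PSp E] {P : E → (Fin k → ℝ) → Prop},
    SA (fun z : E × (Fin k → ℝ) => P z.1 z.2) → SA (fun x => ∃ y, P x y) := by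
  induction k with
  | zero =>
    intro E _ P hP
    have h1 : SA (fun x : E => P x 0) :=
      hP.preim (g := fun x : E => (x, (0 : Fin 0 → ℝ))) (PM.id.prodMk (PM.pi fun i => i.elim0))
    convert h1 using 2 with x
    exact ⟨fun ⟨y, hy⟩ => (Subsingleton.elim y 0) ▸ hy, fun h => ⟨0, h⟩⟩
  | succ k ih =>
    intro E _ P hP
    have h1 : SA (fun z : (E × ℝ) × (Fin k → ℝ) => P z.1.1 (Fin.cons z.1.2 z.2)) := by
      refine hP.preim (g := fun z : (E × ℝ) × (Fin k → ℝ) =>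
        (z.1.1, (Fin.cons z.1.2 z.2 : Fin (k + 1) → ℝ))) ?_
      refine PM.id.fst.fst.prodMk (PM.pi fun i => ?_)
      refine Fin.cases ?_ (fun j => ?_) i
      · exact PM.id.fst.snd.toPF
      · exact PM.id.snd.coord j
    have h2 := ih (P := fun (z : E × ℝ) y => P z.1 (Fin.cons z.2 y)) h1
    have h3 := SA.exR (P := fun x v => ∃ y : Fin k → ℝ, P x (Fin.cons v y)) h2
    convert h3 using 2 with x
    exact Fin.exists_fin_succ_pi

theorem SA.ex {P : E → F → Prop} (hP : SA (fun z : E × F => P z.1 z.2)) :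
    SA (fun x => ∃ y, P x y) := by
  have h1 : SA (fun z : E × (Fin (PSp.dim F) → ℝ) => P z.1 (PSp.e.symm z.2)) :=
    hP.preim (g := fun z : E × (Fin (PSp.dim F) → ℝ) => (z.1, (PSp.e.symm z.2 : F)))
      (PM.id.fst.prodMk (PM.esymm.comp PM.id.snd))
  have h2 := SA.exFin (P := fun x y => P x (PSp.e.symm y)) h1
  convert h2 using 2 with x
  exact (PSp.e (E := F)).symm.surjective.exists

theorem SA.all {P : E → F → Prop} (hP : SA (fun z : E × F => P z.1 z.2)) :
    SA (fun x => ∀ y, P x y) := by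
  have := (SA.ex (P := fun x y => ¬ P x y) hP.not).not
  simpa only [not_exists, not_not] using this

theorem SA.finAll {ι : Type*} (s : Finset ι) {P : ι → E → Prop} (hP : ∀ i ∈ s, SA (P i)) :
    SA (fun x => ∀ i ∈ s, P i x) := by
  have := IsSA.biInter s (fun i => {z | P i (PSp.e.symm z)}) hP
  unfold SA
  convert this using 1
  ext z
  simp

end PSpace

/-! ### Generic boxes and the dichotomy principle -/

theorem poly_nonvanish {d : ℕ} (p : MvPolynomial (Fin d) ℝ) (hp : p ≠ 0) {O : Set (Fin d → ℝ)}
    (hO : IsOpen O) (hne : O.Nonempty) : ∃ x ∈ O, MvPolynomial.eval x p ≠ 0 := by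
  by_contra hcon
  push Not at hcon
  obtain ⟨x0, hx0⟩ := hne
  obtain ⟨r, hr, hball⟩ := Metric.isOpen_iff.1 hO x0 hx0
  apply hp
  refine MvPolynomial.funext_set (fun i => Metric.ball (x0 i) r) (fun i => ?_) (fun x hx => ?_)
  · rw [Real.ball_eq_Ioo]
    exact Set.Ioo_infinite (by linarith)
  · rw [map_zero]
    apply hcon
    apply hball
    rw [ball_pi _ hr]
    exact hx

theorem sign_eventually {X : Type*} [TopologicalSpace X] {g : X → ℝ} (hg : Continuous g) {x0 : X}
    (h0 : g x0 ≠ 0) : ∀ᶠ x in 𝓝 x0, SignType.sign (g x) = SignType.sign (g x0) := by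
  rcases lt_or_gt_of_ne h0 with h | h
  · filter_upwards [hg.continuousAt.eventually (gt_mem_nhds h)] with x hx
    rw [sign_neg h, sign_neg hx]
  · filter_upwards [hg.continuousAt.eventually (lt_mem_nhds h)] with x hx
    rw [sign_pos h, sign_pos hx]

/-- valid data for a box -/
def Bx {m : ℕ} (O : Set (Fin m → ℝ)) (a : ℝ) : Prop := IsOpen O ∧ O.Nonempty ∧ 0 < a

/-- a property of boxes holding after shrinking -/
def Gen {m : ℕ} (Q : Set ((Fin m → ℝ) × ℝ) → Prop) : Prop :=
  ∀ O a, Bx O a → ∃ O₁ a₁, Bx O₁ a₁ ∧ O₁ ⊆ O ∧ a₁ ≤ a ∧ Q (O₁ ×ˢ Ioo 0 a₁)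

/-- downward closed property -/
def Dn {m : ℕ} (Q : Set ((Fin m → ℝ) × ℝ) → Prop) : Prop :=
  ∀ S T, S ⊆ T → Q T → Q S

theorem box_mono {m : ℕ} {O O' : Set (Fin m → ℝ)} {a a' : ℝ} (h : O' ⊆ O) (h' : a' ≤ a) :
    O' ×ˢ Ioo 0 a' ⊆ O ×ˢ Ioo 0 a := Set.prod_mono h (Ioo_subset_Ioo_right h')

theorem Bx.open {m : ℕ} {O : Set (Fin m → ℝ)} {a : ℝ} (h : Bx O a) : IsOpen (O ×ˢ Ioo 0 a) :=
  h.1.prod isOpen_Ioo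

theorem Bx.ne {m : ℕ} {O : Set (Fin m → ℝ)} {a : ℝ} (h : Bx O a) : (O ×ˢ Ioo 0 a).Nonempty :=
  h.2.1.prod (nonempty_Ioo.2 h.2.2)

theorem Gen.and {m : ℕ} {Q R : Set ((Fin m → ℝ) × ℝ) → Prop} (hQ : Gen Q) (hR : Gen R)
    (dQ : Dn Q) : Gen (fun S => Q S ∧ R S) := by
  intro O a hb
  obtain ⟨O1, a1, b1, h1, h1', q⟩ := hQ O a hb
  obtain ⟨O2, a2, b2, h2, h2', r⟩ := hR O1 a1 b1
  exact ⟨O2, a2, b2, h2.trans h1, h2'.trans h1', dQ _ _ (box_mono h2 h2') q, r⟩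

theorem Gen.fin {m : ℕ} {ι : Type*} (s : Finset ι) {Q : ι → Set ((Fin m → ℝ) × ℝ) → Prop}
    (hQ : ∀ i ∈ s, Gen (Q i)) (dQ : ∀ i ∈ s, Dn (Q i)) : Gen (fun S => ∀ i ∈ s, Q i S) := by
  classical
  induction s using Finset.induction_on with
  | empty => exact fun O a h => ⟨O, a, h, le_rfl, le_rfl, by simp⟩
  | insert i s _ ih =>
    have h1 := Gen.and (hQ i (Finset.mem_insert_self i s))
      (ih (fun j hj => hQ j (Finset.mem_insert_of_mem hj))
        (fun j hj => dQ j (Finset.mem_insert_of_mem hj))) (dQ i (Finset.mem_insert_self i s))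
    intro O a hb
    obtain ⟨O1, a1, b1, h1, h1', q, r⟩ := h1 O a hb
    refine ⟨O1, a1, b1, h1, h1', fun j hj => ?_⟩
    rcases Finset.mem_insert.1 hj with rfl | hj
    · exact q
    · exact r j hj

theorem cons_continuous {m : ℕ} :
    Continuous (fun z : (Fin m → ℝ) × ℝ => (Fin.cons z.2 z.1 : Fin (m + 1) → ℝ)) := by
  refine continuous_pi fun i => ?_
  refine Fin.cases ?_ (fun j => ?_) i
  · exact continuous_snd
  · exact (continuous_apply j).comp continuous_fst

theorem gen_poly {m : ℕ} (p : MvPolynomial (Fin (m + 1)) ℝ) :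
    Gen (fun S : Set ((Fin m → ℝ) × ℝ) => ∃ σ : SignType, ∀ z ∈ S,
      SignType.sign (MvPolynomial.eval (Fin.cons z.2 z.1 : Fin (m + 1) → ℝ) p) = σ) := by
  intro O a hb
  by_cases hp : p = 0
  · exact ⟨O, a, hb, le_rfl, le_rfl, 0, by simp [hp]⟩
  have hq : MvPolynomial.finSuccEquiv ℝ m p ≠ 0 := by simpa using hp
  obtain ⟨g, hg, hnd⟩ := Polynomial.exists_eq_pow_rootMultiplicity_mul_and_not_dvd _ hq 0
  set e := (MvPolynomial.finSuccEquiv ℝ m p).rootMultiplicity 0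
  rw [Polynomial.dvd_iff_isRoot, Polynomial.IsRoot.def] at hnd
  obtain ⟨x0, hx0, hne⟩ := poly_nonvanish _ hnd hb.1 hb.2.1
  set P := (MvPolynomial.finSuccEquiv ℝ m).symm g with hP
  have hgP : g = MvPolynomial.finSuccEquiv ℝ m P := by simp [hP]
  have hcont : Continuous (fun z : (Fin m → ℝ) × ℝ =>
      MvPolynomial.eval (Fin.cons z.2 z.1 : Fin (m + 1) → ℝ) P) :=
    (MvPolynomial.continuous_eval P).comp cons_continuous
  have h0 : MvPolynomial.eval (Fin.cons ((x0, (0:ℝ)).2) ((x0, (0:ℝ)).1) : Fin (m + 1) → ℝ) P ≠ 0 := by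
    rw [MvPolynomial.eval_eq_eval_mv_eval', ← hgP]
    have h1 := Polynomial.eval_map_apply (MvPolynomial.eval x0) (p := g) 0
    rw [map_zero] at h1
    simpa [h1] using hne
  have hev := sign_eventually hcont h0
  rw [nhds_prod_eq, Filter.eventually_prod_iff] at hev
  obtain ⟨pa, hpa, pb, hpb, hab⟩ := hev
  obtain ⟨O1, hO1, hO1o, hx1⟩ := eventually_nhds_iff.1 hpa
  obtain ⟨r, hr, hrb⟩ := Metric.eventually_nhds_iff.1 hpb
  refine ⟨O ∩ O1, min a r, ⟨hb.1.inter hO1o, ⟨x0, hx0, hx1⟩, lt_min hb.2.2 hr⟩,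
    inter_subset_left, min_le_left _ _, ?_, fun z hz => ?_⟩
  · exact SignType.sign
      (MvPolynomial.eval (Fin.cons ((x0, (0:ℝ)).2) ((x0, (0:ℝ)).1) : Fin (m + 1) → ℝ) P)
  · obtain ⟨⟨hz1, hz2⟩, hz3, hz4⟩ := hz
    have h2 := hab (hO1 _ hz2) (hrb (y := z.2) (by
      rw [Real.dist_eq, sub_zero, abs_of_pos hz3]
      exact lt_of_lt_of_le hz4 (min_le_right _ _)))
    rw [← h2, MvPolynomial.eval_eq_eval_mv_eval', hg, MvPolynomial.eval_eq_eval_mv_eval', ← hgP]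
    rw [Polynomial.map_mul, Polynomial.eval_mul, sign_mul]
    have h3 : Polynomial.eval z.2 (Polynomial.map (MvPolynomial.eval z.1)
        ((Polynomial.X - Polynomial.C 0) ^ e)) = z.2 ^ e := by
      simp
    rw [h3, sign_pos (pow_pos hz3 e), one_mul]

theorem gen_dich {m : ℕ} {A : (Fin m → ℝ) × ℝ → Prop} (hA : SA A) :
    Gen (fun S => (∀ z ∈ S, A z) ∨ (∀ z ∈ S, ¬ A z)) := by
  have h1 : SA (fun w : Fin (m + 1) → ℝ => A (Fin.tail w, w 0)) := by
    refine hA.preim (g := fun w : Fin (m + 1) → ℝ => (Fin.tail w, w 0)) ?_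
    refine PM.prodMk ?_ (PM.id.coord 0).toPM
    exact PM.pi fun i => PM.id.coord i.succ
  have h2 : IsSA {w : Fin (m + 1) → ℝ | A (Fin.tail w, w 0)} := h1
  obtain ⟨L, hL⟩ := h2.sat
  have h3 := Gen.fin L (fun p _ => gen_poly p) (by
    rintro p _ S T hST ⟨σ, h⟩
    exact ⟨σ, fun z hz => h z (hST hz)⟩)
  intro O a hb
  obtain ⟨O1, a1, b1, s1, s2, q⟩ := h3 O a hb
  refine ⟨O1, a1, b1, s1, s2, ?_⟩
  obtain ⟨z0, hz0⟩ := b1.ne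
  have key : ∀ z ∈ O1 ×ˢ Ioo 0 a1, (A z ↔ A z0) := by
    intro z hz
    have := hL (Fin.cons z.2 z.1) (Fin.cons z0.2 z0.1) (fun p hp => by
      obtain ⟨σ, hσ⟩ := q p hp
      rw [hσ z hz, hσ z0 hz0])
    simpa using this
  by_cases h : A z0
  · exact Or.inl fun z hz => (key z hz).2 h
  · exact Or.inr fun z hz hh => h ((key z hz).1 hh)

theorem loc_dich {m : ℕ} {A : (Fin m → ℝ) × ℝ → Prop} (hA : SA A) {W : Set ((Fin m → ℝ) × ℝ)}
    (hW : IsOpen W) (hne : W.Nonempty) : ∃ W' ⊆ W, IsOpen W' ∧ W'.Nonempty ∧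
      ((∀ z ∈ W', A z) ∨ (∀ z ∈ W', ¬ A z)) := by
  obtain ⟨⟨x0, t0⟩, h0⟩ := hne
  obtain ⟨r, hr, hball⟩ := Metric.isOpen_iff.1 hW _ h0
  have h1 : SA (fun z : (Fin m → ℝ) × ℝ => A (z.1, z.2 + t0)) :=
    hA.preim (g := fun z : (Fin m → ℝ) × ℝ => (z.1, z.2 + t0))
      (PM.id.fst.prodMk (PM.id.snd.toPF.add (PF.const t0)).toPM)
  obtain ⟨O, a, hb, s1, s2, q⟩ := gen_dich h1 (Metric.ball x0 r) r
    ⟨Metric.isOpen_ball, ⟨x0, Metric.mem_ball_self hr⟩, hr⟩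
  have hsub : ∀ z ∈ O ×ˢ Ioo t0 (t0 + a), (z.1, z.2 - t0) ∈ O ×ˢ Ioo 0 a := by
    rintro z ⟨hz1, hz2, hz3⟩
    exact ⟨hz1, by simpa using hz2, by show z.2 - t0 < a; linarith⟩
  refine ⟨O ×ˢ Ioo t0 (t0 + a), ?_, hb.1.prod isOpen_Ioo,
    hb.2.1.prod (nonempty_Ioo.2 (by linarith [hb.2.2])), ?_⟩
  · rintro z ⟨hz1, hz2, hz3⟩
    apply hball
    rw [Metric.mem_ball, Prod.dist_eq]
    refine max_lt (s1 hz1) ?_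
    show dist z.2 t0 < r
    rw [Real.dist_eq, abs_of_pos (by linarith)]
    linarith
  · rcases q with q | q
    · refine Or.inl fun z hz => ?_
      have := q _ (hsub z hz)
      simpa using this
    · refine Or.inr fun z hz => ?_
      have := q _ (hsub z hz)
      simpa using this

/-! ### Semialgebraic functions: generic continuity -/

/-- semialgebraic function -/
def SAFun {E : Type} [PSp E] (f : E → ℝ) : Prop := SA (fun z : E × ℝ => z.2 = f z.1)

theorem SAFun.comp {E : Type} [PSp E] {f : E → ℝ} (hf : SAFun f) {Q : E → ℝ → Prop}
    (hQ : SA (fun z : E × ℝ => Q z.1 z.2)) : SA (fun x => Q x (f x)) := by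
  have := SA.ex (P := fun (x : E) (y : ℝ) => y = f x ∧ Q x y) (hf.and hQ)
  simpa using this

theorem SAFun.dense_cont {m : ℕ} {f : (Fin m → ℝ) × ℝ → ℝ} (hf : SAFun f) :
    Dense {z | ContinuousAt f z} := by
  let G : ℚ × ℚ → Set ((Fin m → ℝ) × ℝ) := fun qr => (frontier {z | (qr.1 : ℝ) < f z ∧ f z < qr.2})ᶜ
  have hSA : ∀ qr : ℚ × ℚ, SA (fun z : (Fin m → ℝ) × ℝ => (qr.1 : ℝ) < f z ∧ f z < qr.2) := by
    intro qr
    exact hf.comp (Q := fun _ y => (qr.1 : ℝ) < y ∧ y < qr.2)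
      ((SA.lt (PF.const _) PM.id.snd.toPF).and (SA.lt PM.id.snd.toPF (PF.const _)))
  have hd : Dense (⋂ qr, G qr) := by
    refine dense_iInter_of_isOpen (fun qr => isClosed_frontier.isOpen_compl) (fun qr => ?_)
    rw [← interior_eq_empty_iff_dense_compl]
    by_contra hne
    obtain ⟨W, hW, hWo, hWn, hA⟩ := loc_dich (hSA qr) isOpen_interior
      (nonempty_iff_ne_empty.2 hne)
    obtain ⟨z, hz⟩ := hWn
    have hzf := interior_subset (hW hz)
    rcases hA with hA | hA
    · have : z ∈ interior {z | (qr.1 : ℝ) < f z ∧ f z < qr.2} :=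
        interior_maximal (fun w hw => hA w hw) hWo hz
      exact hzf.2 this
    · have : z ∈ interior {z | (qr.1 : ℝ) < f z ∧ f z < qr.2}ᶜ :=
        interior_maximal (fun w hw => hA w hw) hWo hz
      rw [interior_compl] at this
      exact this hzf.1
  refine hd.mono fun z hz => ?_
  rw [mem_iInter] at hz
  show ContinuousAt f z
  rw [ContinuousAt, tendsto_order]
  constructor
  · intro l hl
    obtain ⟨q, hq1, hq2⟩ := exists_rat_btwn hl
    obtain ⟨r, hr1, _⟩ := exists_rat_btwn (lt_add_one (f z))
    have h1 : z ∈ interior {z | (q : ℝ) < f z ∧ f z < r} := by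
      by_contra hcon
      exact hz (q, r) ⟨subset_closure ⟨hq2, hr1⟩, hcon⟩
    filter_upwards [mem_interior_iff_mem_nhds.1 h1] with w hw
    exact hq1.trans hw.1
  · intro l hl
    obtain ⟨r, hr1, hr2⟩ := exists_rat_btwn hl
    obtain ⟨q, _, hq2⟩ := exists_rat_btwn (sub_one_lt (f z))
    have h1 : z ∈ interior {z | (q : ℝ) < f z ∧ f z < r} := by
      by_contra hcon
      exact hz (q, r) ⟨subset_closure ⟨hq2, hr1⟩, hcon⟩
    filter_upwards [mem_interior_iff_mem_nhds.1 h1] with w hw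
    exact hw.2.trans hr2

theorem SA.absSubLt {E : Type} [PSp E] {f g h : E → ℝ} (hf : PF f) (hg : PF g) (hh : PF h) :
    SA (fun x => |f x - g x| < h x) := by
  have := (SA.lt (hf.sub hg) hh).and (SA.lt (hg.sub hf) hh)
  convert this using 2 with x
  rw [abs_sub_lt_iff]

theorem SA.distLt {m : ℕ} {E : Type} [PSp E] {f g : E → (Fin m → ℝ) × ℝ} {h : E → ℝ}
    (hf : PM f) (hg : PM g) (hh : PF h) : SA (fun x => 0 < h x ∧ dist (f x) (g x) < h x) := by
  have h1 : SA (fun x => 0 < h x ∧ ((∀ i ∈ (Finset.univ : Finset (Fin m)),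
      |(f x).1 i - (g x).1 i| < h x) ∧ |(f x).2 - (g x).2| < h x)) := by
    refine (SA.pos hh).and (SA.and (SA.finAll _ fun i _ => ?_) ?_)
    · exact SA.absSubLt (hf.fst.coord i) (hg.fst.coord i) hh
    · exact SA.absSubLt hf.snd.toPF hg.snd.toPF hh
  convert h1 using 2 with x
  refine and_congr_right fun hpos => ?_
  rw [Prod.dist_eq, max_lt_iff, dist_pi_lt_iff hpos]
  simp [Real.dist_eq]

theorem SAFun.contSA {m : ℕ} {f : (Fin m → ℝ) × ℝ → ℝ} (hf : SAFun f) :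
    SA (fun z => ContinuousAt f z) := by
  have h0 : SA (fun u : ((((Fin m → ℝ) × ℝ) × ℝ) × ℝ) × ((Fin m → ℝ) × ℝ) =>
      ∀ y : ℝ × ℝ, (y.1 = f u.2 ∧ y.2 = f u.1.1.1) → |y.1 - y.2| < u.1.1.2) := by
    refine SA.all (P := fun (u : ((((Fin m → ℝ) × ℝ) × ℝ) × ℝ) × ((Fin m → ℝ) × ℝ)) (y : ℝ × ℝ) =>
      (y.1 = f u.2 ∧ y.2 = f u.1.1.1) → |y.1 - y.2| < u.1.1.2) ?_
    refine SA.imp (SA.and ?_ ?_) ?_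
    · exact SA.preim hf (g := fun v : (((((Fin m → ℝ) × ℝ) × ℝ) × ℝ) × ((Fin m → ℝ) × ℝ)) × (ℝ × ℝ) =>
        (v.1.2, v.2.1)) (PM.id.fst.snd.prodMk PM.id.snd.fst)
    · exact SA.preim hf (g := fun v : (((((Fin m → ℝ) × ℝ) × ℝ) × ℝ) × ((Fin m → ℝ) × ℝ)) × (ℝ × ℝ) =>
        (v.1.1.1.1, v.2.2)) (PM.id.fst.fst.fst.fst.prodMk PM.id.snd.snd)
    · exact SA.absSubLt PM.id.snd.fst.toPF PM.id.snd.snd.toPF PM.id.fst.fst.fst.snd.toPF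
  have h1 : SA (fun u : ((((Fin m → ℝ) × ℝ) × ℝ) × ℝ) × ((Fin m → ℝ) × ℝ) =>
      (0 < u.1.2 ∧ dist u.2 u.1.1.1 < u.1.2) →
      ∀ y : ℝ × ℝ, (y.1 = f u.2 ∧ y.2 = f u.1.1.1) → |y.1 - y.2| < u.1.1.2) :=
    (SA.distLt PM.id.snd PM.id.fst.fst.fst PM.id.fst.snd.toPF).imp h0
  have h2 := SA.all (P := fun (u : (((Fin m → ℝ) × ℝ) × ℝ) × ℝ) (w : (Fin m → ℝ) × ℝ) =>
      (0 < u.2 ∧ dist w u.1.1 < u.2) →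
      ∀ y : ℝ × ℝ, (y.1 = f w ∧ y.2 = f u.1.1) → |y.1 - y.2| < u.1.2) h1
  have h3 : SA (fun u : (((Fin m → ℝ) × ℝ) × ℝ) × ℝ => 0 < u.2) := SA.pos PM.id.snd.toPF
  have h4 := SA.ex (P := fun (u : ((Fin m → ℝ) × ℝ) × ℝ) (δ : ℝ) => 0 < δ ∧ ∀ w : (Fin m → ℝ) × ℝ,
      (0 < δ ∧ dist w u.1 < δ) →
      ∀ y : ℝ × ℝ, (y.1 = f w ∧ y.2 = f u.1) → |y.1 - y.2| < u.2) (h3.and h2)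
  have h5 : SA (fun u : ((Fin m → ℝ) × ℝ) × ℝ => 0 < u.2) := SA.pos PM.id.snd.toPF
  have h6 := SA.all (P := fun (u : (Fin m → ℝ) × ℝ) (ε : ℝ) => 0 < ε → ∃ δ : ℝ, 0 < δ ∧
      ∀ w : (Fin m → ℝ) × ℝ, (0 < δ ∧ dist w u < δ) →
      ∀ y : ℝ × ℝ, (y.1 = f w ∧ y.2 = f u) → |y.1 - y.2| < ε) (h5.imp h4)
  convert h6 using 2 with z
  rw [Metric.continuousAt_iff]
  constructor
  · intro h ε hε
    obtain ⟨δ, hδ, hh⟩ := h ε hε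
    refine ⟨δ, hδ, fun w hw y hy => ?_⟩
    rw [hy.1, hy.2]
    exact hh hw.2
  · intro h ε hε
    obtain ⟨δ, hδ, hh⟩ := h ε hε
    exact ⟨δ, hδ, fun w hw => hh w ⟨hδ, hw⟩ (f w, f z) ⟨rfl, rfl⟩⟩

theorem SAFun.gen_cont {m : ℕ} {f : (Fin m → ℝ) × ℝ → ℝ} (hf : SAFun f) :
    Gen (fun S => ∀ z ∈ S, ContinuousAt f z) := by
  intro O a hb
  obtain ⟨O1, a1, b1, s1, s2, q⟩ := gen_dich hf.contSA O a hb
  refine ⟨O1, a1, b1, s1, s2, ?_⟩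
  rcases q with q | q
  · exact q
  · obtain ⟨z, hz, hz'⟩ := hf.dense_cont.inter_open_nonempty _ b1.open b1.ne
    exact absurd hz' (q z hz)

/-! ### Semialgebraic functions: generic smoothness -/

theorem PM.evalMv {E : Type} [PSp E] {n : ℕ} {g : E → Fin n → ℝ} (hg : PM g)
    (p : MvPolynomial (Fin n) ℝ) : PF (fun x => MvPolynomial.eval (g x) p) := by
  have : PF (fun w : Fin n → ℝ => MvPolynomial.eval w p) := ⟨p, fun x => rfl⟩
  exact this.comp hg

theorem PM.cons {E : Type} [PSp E] {n : ℕ} {g : E → Fin n → ℝ} {h : E → ℝ} (hh : PF h) (hg : PM g) :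
    PM (fun x => (Fin.cons (h x) (g x) : Fin (n + 1) → ℝ)) := by
  refine PM.pi fun i => ?_
  refine Fin.cases ?_ (fun j => ?_) i
  · exact hh
  · exact hg.coord j

theorem contDiff_eval {n : ℕ} {k : WithTop ℕ∞} (p : MvPolynomial (Fin n) ℝ) :
    ContDiff ℝ k (fun w : Fin n → ℝ => MvPolynomial.eval w p) := by
  induction p using MvPolynomial.induction_on with
  | C a => simpa using contDiff_const
  | add p q hp hq => simpa using hp.add hq
  | mul_X p i hp => simpa using hp.mul (contDiff_apply ℝ ℝ i)

theorem SAFun.graph_poly {m : ℕ} {f : (Fin m → ℝ) × ℝ → ℝ} (hf : SAFun f) :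
    ∃ P : MvPolynomial (Fin (m + 1 + 1)) ℝ, P ≠ 0 ∧ ∀ z : (Fin m → ℝ) × ℝ,
      MvPolynomial.eval (Fin.cons (f z) (Fin.cons z.2 z.1 : Fin (m + 1) → ℝ) :
        Fin (m + 1 + 1) → ℝ) P = 0 := by
  classical
  have h1 : SA (fun w : Fin (m + 1 + 1) → ℝ =>
      w 0 = f (Fin.tail (Fin.tail w), (Fin.tail w) 0)) := by
    refine SA.preim hf (g := fun w : Fin (m + 1 + 1) → ℝ =>
      ((Fin.tail (Fin.tail w), (Fin.tail w) 0), w 0)) ?_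
    refine PM.prodMk (PM.prodMk ?_ ?_) (PM.id.coord 0).toPM
    · exact PM.pi fun i => PM.id.coord i.succ.succ
    · exact (PM.id.coord _).toPM
  have h2 : IsSA {w : Fin (m + 1 + 1) → ℝ |
      w 0 = f (Fin.tail (Fin.tail w), (Fin.tail w) 0)} := h1
  obtain ⟨L, hL⟩ := h2.sat
  refine ⟨∏ p ∈ L.filter (fun p => p ≠ 0), p, ?_, fun z => ?_⟩
  · rw [Finset.prod_ne_zero_iff]
    intro p hp
    exact (Finset.mem_filter.1 hp).2
  · set c : ℝ → Fin (m + 1 + 1) → ℝ := fun y =>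
      Fin.cons y (Fin.cons z.2 z.1 : Fin (m + 1) → ℝ) with hc
    have hcc : Continuous c := by
      have h3 : Continuous (fun y : ℝ => ((Fin.cons z.2 z.1 : Fin (m + 1) → ℝ), y)) := by fun_prop
      exact cons_continuous.comp h3
    show MvPolynomial.eval (c (f z)) _ = 0
    rw [map_prod]
    by_contra hne
    rw [← ne_eq, Finset.prod_ne_zero_iff] at hne
    have hev : ∀ᶠ y in 𝓝 (f z), ∀ p ∈ L, SignType.sign (MvPolynomial.eval (c y) p) =
        SignType.sign (MvPolynomial.eval (c (f z)) p) := by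
      rw [Filter.eventually_all_finset]
      intro p hp
      by_cases hp0 : p = 0
      · simp [hp0]
      · exact sign_eventually ((MvPolynomial.continuous_eval p).comp hcc)
          (hne p (Finset.mem_filter.2 ⟨hp, hp0⟩))
    have hev2 : ∀ᶠ y in 𝓝 (f z), y = f z := by
      filter_upwards [hev] with y hy
      have h4 := (hL _ _ hy).2 (by simp [hc])
      simpa [hc] using h4
    obtain ⟨r, hr, hh⟩ := Metric.eventually_nhds_iff.1 hev2
    have := hh (y := f z + r / 2) (by
      rw [Real.dist_eq]
      simp only [add_sub_cancel_left]
      rw [abs_of_pos (by linarith)]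
      linarith)
    linarith

theorem implicit_smooth {E : Type*} [NormedAddCommGroup E] [NormedSpace ℝ E] [CompleteSpace E]
    {k : ℕ} {F : E × ℝ → ℝ} (hF : ContDiff ℝ (k + 1 : ℕ) F) {f : E → ℝ} {p : E}
    (hc : ContinuousAt f p) (h0 : ∀ᶠ q in 𝓝 p, F (q, f q) = 0) {c : ℝ} (hcne : c ≠ 0)
    (hd : HasDerivAt (fun y => F (p, y)) c (f p)) : ContDiffAt ℝ k f p := by
  have cdf : ContDiffAt ℝ (k + 1 : ℕ) F (p, f p) := hF.contDiffAt
  have pn : ((k + 1 : ℕ) : WithTop ℕ∞) ≠ 0 := by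
    exact_mod_cast Nat.succ_ne_zero k
  have hfd : HasFDerivAt F (fderiv ℝ F (p, f p)) (p, f p) :=
    (cdf.differentiableAt pn).hasFDerivAt
  have e1 : HasFDerivAt (fun y => F (p, y))
      (fderiv ℝ F (p, f p) ∘L .inr ℝ E ℝ) (f p) :=
    hfd.comp (f p) (hasFDerivAt_prodMk_right p (f p))
  have e2 := e1.unique hd.hasFDerivAt
  have if₂ : (fderiv ℝ F (p, f p) ∘L .inr ℝ E ℝ).IsInvertible := by
    rw [e2]
    refine ⟨ContinuousLinearEquiv.unitsEquivAut ℝ (Units.mk0 c hcne), ?_⟩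
    ext
    simp
  have h1 := cdf.eventually_apply_eq_iff_implicitFunction pn if₂
  have h2 := cdf.contDiffAt_implicitFunction pn if₂
  have hcp : ContinuousAt (fun q => (q, f q)) p := continuousAt_id.prodMk hc
  have h3 := hcp.eventually h1
  have h00 : F (p, f p) = 0 := h0.self_of_nhds
  have h4 : f =ᶠ[𝓝 p] cdf.implicitFunction pn if₂ := by
    filter_upwards [h3, h0] with q hq hq0
    exact (hq.1 (by rw [hq0, h00])).symm
  refine (h2.congr_of_eventuallyEq h4).of_le ?_
  exact_mod_cast Nat.le_succ k

theorem SAFun.gen_smooth {m : ℕ} {f : (Fin m → ℝ) × ℝ → ℝ} (hf : SAFun f) (k : ℕ) :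
    Gen (fun S => ∀ z ∈ S, ContDiffAt ℝ k f z) := by
  classical
  intro O a hb
  let Φ : (Fin m → ℝ) × ℝ → (Fin (m + 1) → ℝ) := fun z => Fin.cons z.2 z.1
  let D : ℕ → Prop := fun d => ∃ P : Polynomial (MvPolynomial (Fin (m + 1)) ℝ), P ≠ 0 ∧
    P.natDegree = d ∧ ∃ O' a', Bx O' a' ∧ O' ⊆ O ∧ a' ≤ a ∧
      ∀ z ∈ O' ×ˢ Ioo 0 a', (P.map (MvPolynomial.eval (Φ z))).eval (f z) = 0
  have hD : ∃ d, D d := by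
    obtain ⟨P, hP, hv⟩ := hf.graph_poly
    refine ⟨_, MvPolynomial.finSuccEquiv ℝ _ P, by simpa using hP, rfl, O, a, hb, le_rfl, le_rfl,
      fun z _ => ?_⟩
    rw [← MvPolynomial.eval_eq_eval_mv_eval']
    exact hv z
  obtain ⟨P, hP0, hPd, O1, a1, b1, s1, s1', hv⟩ := Nat.find_spec hD
  have hmin := fun d (hd : d < Nat.find hD) => Nat.find_min hD hd
  have hdeg : 0 < P.natDegree := by
    by_contra hcon
    have h0 : P.natDegree = 0 := by omega
    obtain ⟨c, rfl⟩ := Polynomial.natDegree_eq_zero.1 h0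
    have hc0 : c ≠ 0 := by
      rintro rfl
      simp at hP0
    have hopen : IsOpen ((fun w : Fin (m + 1) → ℝ => (Fin.tail w, w 0)) ⁻¹' (O1 ×ˢ Ioo 0 a1)) := by
      refine b1.open.preimage (Continuous.prodMk ?_ (continuous_apply 0))
      exact continuous_pi fun i => continuous_apply i.succ
    obtain ⟨z, hz⟩ := b1.ne
    obtain ⟨w, hw, hw'⟩ := poly_nonvanish c hc0 hopen ⟨Φ z, by simpa [Φ] using hz⟩
    have := hv _ hw
    simp only [Polynomial.map_C, Polynomial.eval_C, Φ, Fin.cons_self_tail] at this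
    exact hw' this
  set P' := Polynomial.derivative P with hP'
  have hP'd : P'.natDegree < P.natDegree := Polynomial.natDegree_derivative_lt hdeg.ne'
  have hP'0 : P' ≠ 0 := by
    intro h
    have := Polynomial.derivative_eq_zero.1 h
    omega
  have evP : ∀ (Q : Polynomial (MvPolynomial (Fin (m + 1)) ℝ)) (z : (Fin m → ℝ) × ℝ) (y : ℝ),
      (Q.map (MvPolynomial.eval (Φ z))).eval y =
      MvPolynomial.eval (Fin.cons y (Φ z) : Fin (m + 1 + 1) → ℝ)
        ((MvPolynomial.finSuccEquiv ℝ _).symm Q) := by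
    intro Q z y
    rw [MvPolynomial.eval_eq_eval_mv_eval']
    simp
  have hSA : SA (fun z => (P'.map (MvPolynomial.eval (Φ z))).eval (f z) = 0) := by
    refine hf.comp (Q := fun z y => (P'.map (MvPolynomial.eval (Φ z))).eval y = 0) ?_
    simp only [evP]
    exact SA.zero (PM.evalMv (PM.cons PM.id.snd.toPF (PM.cons PM.id.fst.snd.toPF PM.id.fst.fst)) _)
  obtain ⟨O2, a2, b2, s2, s2', q⟩ := gen_dich hSA O1 a1 b1
  rcases q with q | q
  · exact absurd ⟨P', hP'0, rfl, O2, a2, b2, s2.trans s1, s2'.trans s1', q⟩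
      (hmin _ (hPd ▸ hP'd))
  obtain ⟨O3, a3, b3, s3, s3', hcont⟩ := hf.gen_cont O2 a2 b2
  refine ⟨O3, a3, b3, (s3.trans s2).trans s1, (s3'.trans s2').trans s1', fun z hz => ?_⟩
  have hz2 := box_mono s3 s3' hz
  refine implicit_smooth (F := fun u => MvPolynomial.eval (Fin.cons u.2 (Φ u.1) :
    Fin (m + 1 + 1) → ℝ) ((MvPolynomial.finSuccEquiv ℝ _).symm P)) ?_ (hcont z hz) ?_ (q z hz2) ?_
  · refine (contDiff_eval _).comp (contDiff_pi.2 fun i => ?_)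
    refine Fin.cases ?_ (fun j => Fin.cases ?_ (fun l => ?_) j) i
    · exact contDiff_snd
    · exact contDiff_snd.comp contDiff_fst
    · exact (contDiff_apply ℝ ℝ l).comp (contDiff_fst.comp contDiff_fst)
  · filter_upwards [b2.open.mem_nhds hz2] with w hw
    have := hv w (box_mono s2 s2' hw)
    rw [evP] at this
    exact this
  · simp only [← evP]
    have := Polynomial.hasDerivAt (P.map (MvPolynomial.eval (Φ z))) (f z)
    rwa [Polynomial.derivative_map] at this

/-! ### Closed lifts and definable choice -/

/-- `S` is the projection of a closed semialgebraic set -/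
def Lift {d : ℕ} (S : Set (Fin d → ℝ)) : Prop :=
  ∃ (N : ℕ) (C : (Fin d → ℝ) × (Fin N → ℝ) → Prop), SA C ∧ IsClosed {z | C z} ∧
    ∀ x, x ∈ S ↔ ∃ u, C (x, u)

theorem Lift.of_closed {d : ℕ} {S : Set (Fin d → ℝ)} (h : IsSA S) (hc : IsClosed S) : Lift S := by
  refine ⟨0, fun z => z.1 ∈ S, ?_, hc.preimage continuous_fst, fun x => ?_⟩
  · have : SA (fun z : Fin d → ℝ => z ∈ S) := h
    exact this.preim (g := fun z : (Fin d → ℝ) × (Fin 0 → ℝ) => z.1) PM.id.fst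
  · simp

theorem PM.left {E : Type} [PSp E] {a b : ℕ} {g : E → Fin (a + b) → ℝ} (hg : PM g) :
    PM (fun x => fun i => g x (Fin.castAdd b i)) := PM.pi fun i => hg.coord (Fin.castAdd b i)
theorem PM.right {E : Type} [PSp E] {a b : ℕ} {g : E → Fin (a + b) → ℝ} (hg : PM g) :
    PM (fun x => fun i => g x (Fin.natAdd a i)) := PM.pi fun i => hg.coord (Fin.natAdd a i)

theorem lift_aux {d : ℕ} {S T : Set (Fin d → ℝ)} (hS : Lift S) (hT : Lift T) :
    Lift (S ∩ T) ∧ Lift (S ∪ T) := by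
  obtain ⟨a, C, c1, c2, c3⟩ := hS
  obtain ⟨b, D, d1, d2, d3⟩ := hT
  have e1 := c1.preim (g := fun z : (Fin d → ℝ) × (Fin (a + b) → ℝ) =>
    (z.1, fun i => z.2 (Fin.castAdd b i))) (PM.id.fst.prodMk PM.id.snd.left)
  have e2 := d1.preim (g := fun z : (Fin d → ℝ) × (Fin (a + b) → ℝ) =>
    (z.1, fun i => z.2 (Fin.natAdd a i))) (PM.id.fst.prodMk PM.id.snd.right)
  have f1 : IsClosed {z : (Fin d → ℝ) × (Fin (a + b) → ℝ) |
      C (z.1, fun i => z.2 (Fin.castAdd b i))} := by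
    refine c2.preimage (f := fun z : (Fin d → ℝ) × (Fin (a + b) → ℝ) =>
      (z.1, fun i => z.2 (Fin.castAdd b i))) ?_
    fun_prop
  have f2 : IsClosed {z : (Fin d → ℝ) × (Fin (a + b) → ℝ) |
      D (z.1, fun i => z.2 (Fin.natAdd a i))} := by
    refine d2.preimage (f := fun z : (Fin d → ℝ) × (Fin (a + b) → ℝ) =>
      (z.1, fun i => z.2 (Fin.natAdd a i))) ?_
    fun_prop
  constructor
  · refine ⟨a + b, _, e1.and e2, f1.inter f2, fun x => ?_⟩
    rw [mem_inter_iff, c3, d3]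
    constructor
    · rintro ⟨⟨u, hu⟩, ⟨v, hv⟩⟩
      exact ⟨Fin.append u v, by simpa using hu, by simpa using hv⟩
    · rintro ⟨u, hu, hv⟩
      exact ⟨⟨_, hu⟩, ⟨_, hv⟩⟩
  · refine ⟨a + b, _, e1.or e2, f1.union f2, fun x => ?_⟩
    rw [mem_union, c3, d3]
    constructor
    · rintro (⟨u, hu⟩ | ⟨v, hv⟩)
      · exact ⟨Fin.append u 0, Or.inl (by simpa using hu)⟩
      · exact ⟨Fin.append 0 v, Or.inr (by simpa using hv)⟩
    · rintro ⟨u, hu | hv⟩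
      · exact Or.inl ⟨_, hu⟩
      · exact Or.inr ⟨_, hv⟩

theorem IsSA.lift2 {d : ℕ} {S : Set (Fin d → ℝ)} (h : IsSA S) : Lift S ∧ Lift Sᶜ := by
  induction h with
  | pos p =>
    constructor
    · refine ⟨1, fun z => MvPolynomial.eval z.1 p * z.2 0 ^ 2 = 1, ?_, ?_, fun x => ?_⟩
      · exact SA.eq ((PM.id.fst.evalMv p).mul ((PM.id.snd.coord 0).pow 2)) (PF.const 1)
      · have := MvPolynomial.continuous_eval p
        exact isClosed_eq (by fun_prop) continuous_const
      · constructor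
        · intro (hx : 0 < MvPolynomial.eval x p)
          refine ⟨fun _ => (Real.sqrt (MvPolynomial.eval x p))⁻¹, ?_⟩
          show MvPolynomial.eval x p * (Real.sqrt (MvPolynomial.eval x p))⁻¹ ^ 2 = 1
          rw [inv_pow, Real.sq_sqrt hx.le, mul_inv_cancel₀ hx.ne']
        · rintro ⟨u, hu⟩
          show 0 < MvPolynomial.eval x p
          have hu' : MvPolynomial.eval x p * u 0 ^ 2 = 1 := hu
          by_contra hcon
          nlinarith [sq_nonneg (u 0)]
    · refine Lift.of_closed (IsSA.pos p).compl (IsOpen.isClosed_compl ?_)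
      exact isOpen_lt continuous_const (MvPolynomial.continuous_eval p)
  | zero p =>
    constructor
    · refine Lift.of_closed (IsSA.zero p) ?_
      exact isClosed_eq (MvPolynomial.continuous_eval p) continuous_const
    · refine ⟨1, fun z => MvPolynomial.eval z.1 p * z.2 0 = 1, ?_, ?_, fun x => ?_⟩
      · exact SA.eq ((PM.id.fst.evalMv p).mul (PM.id.snd.coord 0)) (PF.const 1)
      · have := MvPolynomial.continuous_eval p
        exact isClosed_eq (by fun_prop) continuous_const
      · constructor
        · intro (hx : MvPolynomial.eval x p ≠ 0)
          exact ⟨fun _ => (MvPolynomial.eval x p)⁻¹, mul_inv_cancel₀ hx⟩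
        · rintro ⟨u, hu⟩
          show MvPolynomial.eval x p ≠ 0
          intro h0
          have hu' : MvPolynomial.eval x p * u 0 = 1 := hu
          rw [h0, zero_mul] at hu'
          exact zero_ne_one hu'
  | union _ _ ih1 ih2 =>
    refine ⟨(lift_aux ih1.1 ih2.1).2, ?_⟩
    rw [compl_union]
    exact (lift_aux ih1.2 ih2.2).1
  | compl _ ih =>
    refine ⟨ih.2, ?_⟩
    rw [compl_compl]
    exact ih.1

/-- fiberwise minimizers -/
def minS {E F : Type} (h : F → ℝ) (S : E → F → Prop) : E → F → Prop :=
  fun p w => S p w ∧ ∀ w', S p w' → h w ≤ h w'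

theorem minS_SA {E F : Type} [PSp E] [PSp F] {h : F → ℝ} (hh : PF h) {S : E → F → Prop}
    (hS : SA (fun z : E × F => S z.1 z.2)) : SA (fun z : E × F => minS h S z.1 z.2) := by
  refine hS.and (SA.all (P := fun (z : E × F) (w' : F) => S z.1 w' → h z.2 ≤ h w') (SA.imp ?_ ?_))
  · exact hS.preim (g := fun v : (E × F) × F => (v.1.1, v.2)) (PM.id.fst.fst.prodMk PM.id.snd)
  · exact SA.le (hh.comp PM.id.fst.snd) (hh.comp PM.id.snd)

theorem minS_compact {E F : Type} [TopologicalSpace F] {h : F → ℝ} (hh : Continuous h)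
    {S : E → F → Prop} {p : E} (hc : IsClosed {w | S p w})
    (hcoer : ∀ w0, IsCompact ({w | S p w} ∩ {w | h w ≤ h w0})) :
    IsCompact {w | minS h S p w} ∧ ((∃ w, S p w) → ∃ w, minS h S p w) := by
  have hex : (∃ w, S p w) → ∃ w, minS h S p w := by
    rintro ⟨w0, hw0⟩
    obtain ⟨w, hw, hmin⟩ := (hcoer w0).exists_isMinOn ⟨w0, hw0, show h w0 ≤ h w0 from le_rfl⟩ hh.continuousOn
    refine ⟨w, hw.1, fun w' hw' => ?_⟩
    by_cases hle : h w' ≤ h w0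
    · exact hmin ⟨hw', hle⟩
    · exact le_trans hw.2 (not_le.1 hle).le
  refine ⟨?_, hex⟩
  by_cases hne : ∃ w, S p w
  · obtain ⟨w1, h1⟩ := hex hne
    have : {w | minS h S p w} = {w | S p w} ∩ {w | h w ≤ h w1} := by
      ext w
      exact ⟨fun hw => ⟨hw.1, hw.2 _ h1.1⟩, fun hw => ⟨hw.1, fun w' hw' => hw.2.trans (h1.2 w' hw')⟩⟩
    rw [this]
    exact hcoer w1
  · have : {w | minS h S p w} = ∅ := by
      ext w
      simp only [mem_ofPred_eq, mem_empty_iff_false, iff_false]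
      exact fun hw => hne ⟨w, hw.1⟩
    rw [this]
    exact isCompact_empty

theorem def_choice {E : Type} [PSp E] {n N : ℕ} {S : E → (Fin n → ℝ) × (Fin N → ℝ) → Prop}
    (hS : SA (fun z : E × ((Fin n → ℝ) × (Fin N → ℝ)) => S z.1 z.2))
    (hcl : ∀ p, IsClosed {w | S p w}) :
    ∃ T : E → (Fin n → ℝ) × (Fin N → ℝ) → Prop,
      SA (fun z : E × ((Fin n → ℝ) × (Fin N → ℝ)) => T z.1 z.2) ∧
      (∀ p w, T p w → S p w) ∧ (∀ p, (∃ w, S p w) → ∃ w, T p w) ∧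
      (∀ p w w', T p w → T p w' → w.1 = w'.1) := by
  have key : ∀ l : List (Fin n), ∃ T : E → (Fin n → ℝ) × (Fin N → ℝ) → Prop,
      SA (fun z : E × ((Fin n → ℝ) × (Fin N → ℝ)) => T z.1 z.2) ∧
      (∀ p w, T p w → S p w) ∧ (∀ p, (∃ w, S p w) → ∃ w, T p w) ∧
      (∀ p, IsCompact {w | T p w}) ∧
      (∀ p w w', T p w → T p w' → ∀ i ∈ l, w.1 i = w'.1 i) := by
    intro l
    induction l with
    | nil =>
      let h : (Fin n → ℝ) × (Fin N → ℝ) → ℝ := fun w => ∑ i, w.1 i ^ 2 + ∑ j, w.2 j ^ 2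
      have hPF : PF h := PF.add (PF.sum fun i _ => (PM.id.fst.coord i).pow 2)
        (PF.sum fun i _ => (PM.id.snd.coord i).pow 2)
      have hcont : Continuous h := by
        show Continuous (fun w : (Fin n → ℝ) × (Fin N → ℝ) => ∑ i, w.1 i ^ 2 + ∑ j, w.2 j ^ 2)
        fun_prop
      have hm : ∀ p, IsCompact {w | minS h S p w} ∧ ((∃ w, S p w) → ∃ w, minS h S p w) := by
        intro p
        refine minS_compact hcont (hcl p) fun w0 => ?_
        refine Metric.isCompact_of_isClosed_isBounded
          ((hcl p).inter (isClosed_le hcont continuous_const)) ?_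
        refine (Metric.isBounded_closedBall (x := 0) (r := h w0 + 1)).subset ?_
        rintro w ⟨_, hw⟩
        have hw' : ∑ i, w.1 i ^ 2 + ∑ j, w.2 j ^ 2 ≤ h w0 := hw
        have a1 : 0 ≤ ∑ i, w.1 i ^ 2 := Finset.sum_nonneg fun i _ => sq_nonneg _
        have a2 : 0 ≤ ∑ i, w.2 i ^ 2 := Finset.sum_nonneg fun i _ => sq_nonneg _
        have aux : ∀ (x : ℝ), x ^ 2 ≤ h w0 → |x| ≤ h w0 + 1 := by
          intro x hx
          rw [abs_le]
          constructor <;> nlinarith [sq_nonneg (x - 1), sq_nonneg (x + 1)]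
        have hnn : 0 ≤ h w0 + 1 := by linarith
        rw [mem_closedBall_zero_iff, Prod.norm_def]
        refine max_le ((pi_norm_le_iff_of_nonneg hnn).2 fun i => aux _ ?_)
          ((pi_norm_le_iff_of_nonneg hnn).2 fun i => aux _ ?_)
        · have := Finset.single_le_sum (f := fun i => w.1 i ^ 2)
            (fun i _ => sq_nonneg _) (Finset.mem_univ i)
          linarith
        · have := Finset.single_le_sum (f := fun i => w.2 i ^ 2)
            (fun i _ => sq_nonneg _) (Finset.mem_univ i)
          linarith
      exact ⟨minS h S, minS_SA hPF hS, fun p w hw => hw.1, fun p => (hm p).2, fun p => (hm p).1,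
        fun p w w' _ _ i hi => by simp at hi⟩
    | cons i l ih =>
      obtain ⟨T, t1, t2, t3, t4, t5⟩ := ih
      let h : (Fin n → ℝ) × (Fin N → ℝ) → ℝ := fun w => w.1 i
      have hcont : Continuous h := by
        show Continuous (fun w : (Fin n → ℝ) × (Fin N → ℝ) => w.1 i)
        fun_prop
      have hm : ∀ p, IsCompact {w | minS h T p w} ∧ ((∃ w, T p w) → ∃ w, minS h T p w) := by
        intro p
        exact minS_compact hcont (t4 p).isClosed fun w0 =>
          (t4 p).inter_right (isClosed_le hcont continuous_const)
      refine ⟨minS h T, minS_SA (PM.id.fst.coord i) t1, fun p w hw => t2 p w hw.1,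
        fun p hp => (hm p).2 (t3 p hp), fun p => (hm p).1, fun p w w' hw hw' j hj => ?_⟩
      rcases List.mem_cons.1 hj with rfl | hj
      · exact le_antisymm (hw.2 _ hw'.1) (hw'.2 _ hw.1)
      · exact t5 p w w' hw.1 hw'.1 j hj
  obtain ⟨T, t1, t2, t3, _, t5⟩ := key (List.finRange n)
  exact ⟨T, t1, t2, t3, fun p w w' hw hw' => funext fun i => t5 p w w' hw hw' i (List.mem_finRange i)⟩

theorem PM.pair {E : Type} [PSp E] {m n : ℕ} {g : E → Fin m → ℝ} {h : E → Fin n → ℝ}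
    (hg : PM g) (hh : PM h) : PM (fun x => (pairEquiv m n).symm (g x, h x)) := by
  refine PM.pi fun i => ?_
  refine Fin.addCases (fun i => ?_) (fun i => ?_) i
  · simp only [pairEquiv_symm_castAdd]; exact hg.coord i
  · simp only [pairEquiv_symm_natAdd]; exact hh.coord i

theorem pair_continuous {m n : ℕ} : Continuous (fun z => (pairEquiv m n).symm z) := by
  refine continuous_pi fun i => ?_
  refine Fin.addCases (fun i => ?_) (fun i => ?_) i
  · have : (fun z : (Fin m → ℝ) × (Fin n → ℝ) => (pairEquiv m n).symm z (Fin.castAdd n i)) =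
      fun z => z.1 i := funext fun z => pairEquiv_symm_castAdd z.1 z.2 i
    rw [this]; fun_prop
  · have : (fun z : (Fin m → ℝ) × (Fin n → ℝ) => (pairEquiv m n).symm z (Fin.natAdd m i)) =
      fun z => z.2 i := funext fun z => pairEquiv_symm_natAdd z.1 z.2 i
    rw [this]; fun_prop

theorem select {m n : ℕ} {Z : Set (Fin (m + n) → ℝ)} (hZ : IsSA Z) :
    ∃ sel : (Fin m → ℝ) × ℝ → Fin n → ℝ, (∀ i, SAFun (fun z => sel z i)) ∧
      ∀ x t, (∃ y, (pairEquiv m n).symm (x, y) ∈ Z ∧ ∑ i, y i ^ 2 = t ^ 2) →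
        (pairEquiv m n).symm (x, sel (x, t)) ∈ Z ∧ ∑ i, sel (x, t) i ^ 2 = t ^ 2 := by
  classical
  obtain ⟨N, C, c1, c2, c3⟩ := hZ.lift2.1
  let S : (Fin m → ℝ) × ℝ → (Fin n → ℝ) × (Fin N → ℝ) → Prop := fun p w =>
    C ((pairEquiv m n).symm (p.1, w.1), w.2) ∧ ∑ i, w.1 i ^ 2 = p.2 ^ 2
  have hS : SA (fun z : ((Fin m → ℝ) × ℝ) × ((Fin n → ℝ) × (Fin N → ℝ)) => S z.1 z.2) := by
    refine SA.and ?_ (SA.eq ?_ ?_)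
    · exact c1.preim (g := fun z : ((Fin m → ℝ) × ℝ) × ((Fin n → ℝ) × (Fin N → ℝ)) =>
        ((pairEquiv m n).symm (z.1.1, z.2.1), z.2.2))
        (PM.prodMk (PM.pair PM.id.fst.fst PM.id.snd.fst) PM.id.snd.snd)
    · exact PF.sum fun i _ => (PM.id.snd.fst.coord i).pow 2
    · exact PM.id.fst.snd.toPF.pow 2
  have hcl : ∀ p, IsClosed {w | S p w} := by
    intro p
    refine IsClosed.inter (s₁ := {w : (Fin n → ℝ) × (Fin N → ℝ) |
      C ((pairEquiv m n).symm (p.1, w.1), w.2)})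
      (s₂ := {w : (Fin n → ℝ) × (Fin N → ℝ) | ∑ i, w.1 i ^ 2 = p.2 ^ 2}) ?_
      (isClosed_eq (by fun_prop) continuous_const)
    refine c2.preimage (f := fun w : (Fin n → ℝ) × (Fin N → ℝ) =>
      ((pairEquiv m n).symm (p.1, w.1), w.2)) ?_
    exact (pair_continuous.comp (continuous_const.prodMk continuous_fst)).prodMk continuous_snd
  obtain ⟨T, t1, t2, t3, t4⟩ := def_choice hS hcl
  let sel : (Fin m → ℝ) × ℝ → Fin n → ℝ := fun p => if h : ∃ w, T p w then h.choose.1 else 0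
  have hsel : ∀ p w, T p w → sel p = w.1 := by
    intro p w hw
    have h : ∃ w, T p w := ⟨w, hw⟩
    simp only [sel, dif_pos h]
    exact t4 p _ _ h.choose_spec hw
  refine ⟨sel, fun i => ?_, fun x t hy => ?_⟩
  · have h1 : SA (fun v : (((Fin m → ℝ) × ℝ) × ℝ) × ((Fin n → ℝ) × (Fin N → ℝ)) =>
        T v.1.1 v.2) := t1.preim (g := fun v : (((Fin m → ℝ) × ℝ) × ℝ) × ((Fin n → ℝ) × (Fin N → ℝ)) =>
          (v.1.1, v.2)) (PM.id.fst.fst.prodMk PM.id.snd)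
    have h2 : SA (fun v : (((Fin m → ℝ) × ℝ) × ℝ) × ((Fin n → ℝ) × (Fin N → ℝ)) =>
        v.2.1 i = v.1.2) := SA.eq (PM.id.snd.fst.coord i) PM.id.fst.snd.toPF
    have h3 := SA.ex (P := fun (v : ((Fin m → ℝ) × ℝ) × ℝ) (w : (Fin n → ℝ) × (Fin N → ℝ)) =>
      T v.1 w ∧ w.1 i = v.2) (h1.and h2)
    have h4 := (SA.ex (P := fun (v : ((Fin m → ℝ) × ℝ) × ℝ) (w : (Fin n → ℝ) × (Fin N → ℝ)) =>
      T v.1 w) h1).not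
    have h5 : SA (fun v : ((Fin m → ℝ) × ℝ) × ℝ => v.2 = 0) := SA.zero PM.id.snd.toPF
    have h6 := h3.or (h4.and h5)
    show SA (fun v : ((Fin m → ℝ) × ℝ) × ℝ => v.2 = sel v.1 i)
    convert h6 using 2 with v
    by_cases hv : ∃ w, T v.1 w
    · obtain ⟨w, hw⟩ := hv
      rw [hsel _ _ hw]
      constructor
      · exact fun h => Or.inl ⟨w, hw, h.symm⟩
      · rintro (⟨w', hw', h⟩ | ⟨h, _⟩)
        · rw [t4 _ _ _ hw hw']; exact h.symm
        · exact absurd ⟨w, hw⟩ h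
    · have : sel v.1 = 0 := by simp only [sel, dif_neg hv]
      rw [this]
      constructor
      · exact fun h => Or.inr ⟨hv, h⟩
      · rintro (⟨w', hw', h⟩ | ⟨_, h⟩)
        · exact absurd ⟨w', hw'⟩ hv
        · exact h
  · obtain ⟨y, hy1, hy2⟩ := hy
    obtain ⟨u, hu⟩ := (c3 _).1 hy1
    obtain ⟨w, hw⟩ := t3 (x, t) ⟨(y, u), hu, hy2⟩
    have := t2 _ _ hw
    rw [hsel _ _ hw]
    exact ⟨(c3 _).2 ⟨w.2, this.1⟩, this.2⟩

/-! ### The final argument -/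

theorem ball_SA {m : ℕ} (x0 : Fin m → ℝ) {r : ℝ} (hr : 0 < r) :
    SA (fun x : Fin m → ℝ => x ∈ Metric.ball x0 r) := by
  have h1 : SA (fun x : Fin m → ℝ => ∀ i ∈ (Finset.univ : Finset (Fin m)), |x i - x0 i| < r) :=
    SA.finAll _ fun i _ => SA.absSubLt (PM.id.coord i) (PF.const _) (PF.const _)
  convert h1 using 2 with x
  rw [Metric.mem_ball, dist_pi_lt_iff hr]
  simp [Real.dist_eq]

theorem exists_box {m n : ℕ} (V : Set (Fin m → ℝ)) (Z : Set (Fin (m + n) → ℝ))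
    (hVo : IsOpen V) (hVne : V.Nonempty) (hZ : IsSA Z)
    (hcl : ∀ x ∈ V, (pairEquiv m n).symm (x, 0) ∈ closure Z)
    (hdisj : ∀ x ∈ V, (pairEquiv m n).symm (x, 0) ∉ Z) :
    ∃ O a, Bx O a ∧ O ⊆ V ∧ ∀ z ∈ O ×ˢ Ioo 0 a,
      ∃ y, (pairEquiv m n).symm (z.1, y) ∈ Z ∧ ∑ i, y i ^ 2 = z.2 ^ 2 := by
  have hW : SA (fun z : (Fin m → ℝ) × ℝ =>
      ∃ y, (pairEquiv m n).symm (z.1, y) ∈ Z ∧ ∑ i, y i ^ 2 = z.2 ^ 2) := by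
    refine SA.ex (P := fun (z : (Fin m → ℝ) × ℝ) (y : Fin n → ℝ) =>
      (pairEquiv m n).symm (z.1, y) ∈ Z ∧ ∑ i, y i ^ 2 = z.2 ^ 2) (SA.and ?_ (SA.eq ?_ ?_))
    · have hZ' : SA (fun w : Fin (m + n) → ℝ => w ∈ Z) := hZ
      exact hZ'.preim (g := fun v : ((Fin m → ℝ) × ℝ) × (Fin n → ℝ) =>
        (pairEquiv m n).symm (v.1.1, v.2)) (PM.pair PM.id.fst.fst PM.id.snd)
    · exact PF.sum fun i _ => (PM.id.snd.coord i).pow 2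
    · exact PM.id.fst.snd.toPF.pow 2
  obtain ⟨O, a, hb, s1, _, q⟩ := gen_dich hW V 1 ⟨hVo, hVne, one_pos⟩
  refine ⟨O, a, hb, s1, ?_⟩
  rcases q with q | q
  · exact q
  exfalso
  obtain ⟨x0, hx0⟩ := hb.2.1
  have c1 : Continuous (fun z : Fin (m + n) → ℝ => (pairEquiv m n z).1) := by
    refine continuous_pi fun i => ?_
    simp only [pairEquiv_fst]
    fun_prop
  have c2 : Continuous (fun z : Fin (m + n) → ℝ => ∑ i, (pairEquiv m n z).2 i ^ 2) := by
    simp only [pairEquiv_snd]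
    fun_prop
  have hop : IsOpen {z : Fin (m + n) → ℝ | (pairEquiv m n z).1 ∈ O ∧
      ∑ i, (pairEquiv m n z).2 i ^ 2 < a ^ 2} :=
    (hb.1.preimage c1).inter (isOpen_lt c2 continuous_const)
  obtain ⟨z, ⟨hz1, hz2⟩, hzZ⟩ := mem_closure_iff.1 (hcl x0 (s1 hx0)) _ hop
    ⟨by simpa using hx0, by simpa using pow_pos hb.2.2 2⟩
  have hzz : (pairEquiv m n).symm ((pairEquiv m n z).1, (pairEquiv m n z).2) = z := by simp
  set x := (pairEquiv m n z).1
  set y := (pairEquiv m n z).2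
  have hnn : 0 ≤ ∑ i, y i ^ 2 := Finset.sum_nonneg fun i _ => sq_nonneg _
  have hpos : 0 < ∑ i, y i ^ 2 := by
    refine lt_of_le_of_ne hnn fun h0 => ?_
    have hy : y = 0 := by
      funext i
      have := (Finset.sum_eq_zero_iff_of_nonneg (fun i _ => sq_nonneg (y i))).1 h0.symm i
        (Finset.mem_univ i)
      simpa using this
    rw [hy] at hzz
    exact hdisj x (s1 hz1) (hzz ▸ hzZ)
  refine q (x, Real.sqrt (∑ i, y i ^ 2)) ⟨hz1, Real.sqrt_pos.2 hpos, ?_⟩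
    ⟨y, by rw [hzz]; exact hzZ, (Real.sq_sqrt hnn).symm⟩
  exact (Real.sqrt_lt' hb.2.2).2 hz2

theorem family_curve_selection {m n k : ℕ} (V : Set (Fin m → ℝ)) (Z : Set (Fin (m + n) → ℝ))
    (hV : IsSA V) (hVo : IsOpen V) (hVne : V.Nonempty) (hZ : IsSA Z)
    (hcl : ∀ x ∈ V, (pairEquiv m n).symm (x, 0) ∈ closure Z)
    (hdisj : ∀ x ∈ V, (pairEquiv m n).symm (x, 0) ∉ Z) :
    ∃ (U : Set (Fin m → ℝ)) (a : ℝ) (c : (Fin m → ℝ) → ℝ → Fin n → ℝ),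
      U.Nonempty ∧ IsSA U ∧ IsOpen U ∧ U ⊆ V ∧ 0 < a ∧
      ContinuousOn (fun p : (Fin m → ℝ) × ℝ => c p.1 p.2) (U ×ˢ Set.Ico 0 a) ∧
      IsSAMapOn {z : Fin (m + 1) → ℝ | Fin.init z ∈ U ∧ z (Fin.last m) ∈ Set.Ico 0 a}
        (fun z => c (Fin.init z) (z (Fin.last m))) ∧
      (∀ x ∈ U, c x 0 = 0) ∧
      (∀ x ∈ U, ∀ t ∈ Set.Ioo 0 a,
        (pairEquiv m n).symm (x, c x t) ∈ Z ∧ euclNorm (c x t) = t) ∧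
      ContDiffOn ℝ k (fun p : (Fin m → ℝ) × ℝ => c p.1 p.2) (U ×ˢ Set.Ioo 0 a) := by
  classical
  obtain ⟨sel, hsel, hselZ⟩ := select hZ
  obtain ⟨O1, a1, b1, s1, hW⟩ := exists_box V Z hVo hVne hZ hcl hdisj
  obtain ⟨O2, a, b2, s2, s2', hsm⟩ := Gen.fin (Finset.univ : Finset (Fin n))
    (fun i _ => (hsel i).gen_smooth k) (fun i _ S T hST h z hz => h z (hST hz)) O1 a1 b1
  obtain ⟨x0, hx0⟩ := b2.2.1
  obtain ⟨r, hr, hball⟩ := Metric.isOpen_iff.1 b2.1 x0 hx0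
  have hprop : ∀ x ∈ Metric.ball x0 r, ∀ t ∈ Set.Ioo 0 a,
      (pairEquiv m n).symm (x, sel (x, t)) ∈ Z ∧ ∑ i, sel (x, t) i ^ 2 = t ^ 2 :=
    fun x hx t ht => hselZ x t (hW (x, t) (box_mono s2 s2' ⟨hball hx, ht⟩))
  let c : (Fin m → ℝ) → ℝ → Fin n → ℝ := fun x t => if 0 < t then sel (x, t) else 0
  have cpos : ∀ x t, 0 < t → c x t = sel (x, t) := fun x t ht => if_pos ht
  have cneg : ∀ x t, ¬ 0 < t → c x t = 0 := fun x t ht => if_neg ht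
  have hev : ∀ p : (Fin m → ℝ) × ℝ, 0 < p.2 → ∀ i,
      (fun p : (Fin m → ℝ) × ℝ => c p.1 p.2 i) =ᶠ[𝓝 p] fun p => sel p i := by
    intro p hp i
    filter_upwards [(isOpen_lt continuous_const continuous_snd).mem_nhds hp] with w hw
    rw [cpos _ _ hw]
  have hcd : ∀ p ∈ Metric.ball x0 r ×ˢ Ioo 0 a, ∀ i,
      ContDiffAt ℝ k (fun p : (Fin m → ℝ) × ℝ => c p.1 p.2 i) p := fun p hp i =>
    (hsm i (Finset.mem_univ i) p ⟨hball hp.1, hp.2⟩).congr_of_eventuallyEq (hev p hp.2.1 i)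
  refine ⟨Metric.ball x0 r, a, c, ⟨x0, Metric.mem_ball_self hr⟩, ball_SA x0 hr, Metric.isOpen_ball,
    (hball.trans s2).trans s1, b2.2.2, ?_, ?_, ?_, ?_, ?_⟩
  · rintro ⟨x, t⟩ ⟨hx, ht0, hta⟩
    rw [continuousWithinAt_pi]
    intro i
    rcases lt_or_eq_of_le ht0 with h | h
    · exact (hcd (x, t) ⟨hx, h, hta⟩ i).continuousAt.continuousWithinAt
    · have h' : t = 0 := h.symm
      subst h'
      have e0 : c x 0 i = 0 := by rw [cneg x 0 (lt_irrefl _)]; rfl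
      show Tendsto (fun p : (Fin m → ℝ) × ℝ => c p.1 p.2 i) _ (𝓝 (c x 0 i))
      rw [e0]
      have hlim : Tendsto (fun p : (Fin m → ℝ) × ℝ => p.2)
          (𝓝[Metric.ball x0 r ×ˢ Ico 0 a] (x, 0)) (𝓝 0) :=
        (continuous_snd.tendsto (x, (0 : ℝ))).mono_left nhdsWithin_le_nhds
      refine squeeze_zero_norm' ?_ hlim
      filter_upwards [self_mem_nhdsWithin] with p hp
      by_cases h2 : 0 < p.2
      · rw [cpos _ _ h2, Real.norm_eq_abs]
        have h3 := (hprop p.1 hp.1 p.2 ⟨h2, hp.2.2⟩).2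
        have h4 := Finset.single_le_sum (f := fun i => sel (p.1, p.2) i ^ 2)
          (fun i _ => sq_nonneg _) (Finset.mem_univ i)
        rw [h3] at h4
        exact abs_le_of_sq_le_sq h4 h2.le
      · rw [cneg _ _ h2]
        simpa using hp.2.1
  · have hQ : SA (fun v : ((Fin m → ℝ) × ℝ) × (Fin n → ℝ) =>
        (v.1.1 ∈ Metric.ball x0 r ∧ (0 ≤ v.1.2 ∧ v.1.2 < a)) ∧
        ∀ i ∈ (Finset.univ : Finset (Fin n)),
          ((0 < v.1.2 ∧ v.2 i = sel v.1 i) ∨ (¬ 0 < v.1.2 ∧ v.2 i = 0))) := by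
      have hp : SA (fun v : ((Fin m → ℝ) × ℝ) × (Fin n → ℝ) => 0 < v.1.2) :=
        SA.pos PM.id.fst.snd.toPF
      refine SA.and (SA.and ?_ (SA.and (SA.le (PF.const 0) PM.id.fst.snd.toPF)
        (SA.lt PM.id.fst.snd.toPF (PF.const a)))) (SA.finAll _ fun i _ => ?_)
      · exact (ball_SA x0 hr).preim (g := fun v : ((Fin m → ℝ) × ℝ) × (Fin n → ℝ) => v.1.1)
          PM.id.fst.fst
      · refine SA.or (hp.and ?_) (hp.not.and (SA.zero (PM.id.snd.coord i)))
        exact SA.preim (hsel i) (g := fun v : ((Fin m → ℝ) × ℝ) × (Fin n → ℝ) => (v.1, v.2 i))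
          (PM.id.fst.prodMk (PM.id.snd.coord i).toPM)
    have hg : PM (fun z : Fin (m + 1 + n) → ℝ =>
        (((Fin.init (pairEquiv (m + 1) n z).1 : Fin m → ℝ), (pairEquiv (m + 1) n z).1 (Fin.last m)),
          (pairEquiv (m + 1) n z).2)) := by
      refine PM.prodMk (PM.prodMk (PM.pi fun i => ?_) ?_) (PM.pi fun i => ?_)
      · simp only [Fin.init, pairEquiv_fst]
        exact PM.id.coord _
      · simp only [pairEquiv_fst]
        exact (PM.id.coord _).toPM
      · simp only [pairEquiv_snd]
        exact PM.id.coord _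
    have hfin := hQ.preim hg
    show SA (fun z : Fin (m + 1 + n) → ℝ => z ∈ graphSet
      {z : Fin (m + 1) → ℝ | Fin.init z ∈ Metric.ball x0 r ∧ z (Fin.last m) ∈ Set.Ico 0 a}
      (fun z => c (Fin.init z) (z (Fin.last m))))
    convert hfin using 2 with z
    show ((Fin.init (pairEquiv (m + 1) n z).1 ∈ Metric.ball x0 r ∧
      (pairEquiv (m + 1) n z).1 (Fin.last m) ∈ Set.Ico 0 a) ∧
      c (Fin.init (pairEquiv (m + 1) n z).1) ((pairEquiv (m + 1) n z).1 (Fin.last m)) =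
        (pairEquiv (m + 1) n z).2) ↔ _
    refine and_congr Iff.rfl ?_
    rw [funext_iff]
    simp only [Finset.mem_univ, true_implies]
    refine forall_congr' fun i => ?_
    by_cases h : 0 < (pairEquiv (m + 1) n z).1 (Fin.last m)
    · rw [cpos _ _ h]
      simp [h, eq_comm]
    · rw [cneg _ _ h]
      simp [h, eq_comm]
  · intro x _
    exact cneg x 0 (lt_irrefl _)
  · intro x hx t ht
    obtain ⟨h1, h2⟩ := hprop x hx t ht
    rw [cpos x t ht.1]
    refine ⟨h1, ?_⟩
    rw [euclNorm, h2, Real.sqrt_sq ht.1.le]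
  · rw [contDiffOn_pi]
    intro i p hp
    exact (hcd p hp i).contDiffWithinAt

end
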